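/- arXiv:math/0610742 — 3 statements merged into one kernel-verified Lean document; each statement's English description precedes it below -/
import Mathlib

section
/- Let q ≥ 1 be an integer and let G be a finite simple (q+1)-regular graph on n ≥ 1 vertices with adjacency-matrix eigenvalues λ_1, …, λ_n (listed with multiplicity). Then for every real t > 0, (1/n)·∑_{i=1}^n e^{t·λ_i} ≥ ((q+1)/(2π)) · ∫_{−2√q}^{2√q} e^{s·t} · √(4q − s²)/((q+1)² − s²) ds. -/
open MeasureTheory

section KestenMcKay

/-- Up to normalisation, the `r`-th non-backtracking polynomial of the `(q+1)`-regular tree times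
the Kesten–McKay density, in the coordinate `s = 2 √q cos θ`. -/
noncomputable def kestenMcKayKernel (q : ℝ) (r : ℕ) (θ : ℝ) : ℝ :=
  Real.sin θ * (q * Real.sin ((r + 1) * θ) - Real.sin ((r - 1) * θ)) /
    ((q - 1) ^ 2 + 4 * q * Real.sin θ ^ 2)

theorem integral_cos_natCast_mul (n : ℕ) :
    ∫ θ in 0..Real.pi, Real.cos (n * θ) = if n = 0 then Real.pi else 0 := by
  split_ifs with h
  · simp [h]
  · have hn : (n : ℝ) ≠ 0 := by exact_mod_cast h
    rw [intervalIntegral.integral_comp_mul_left (fun x => Real.cos x) hn]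
    simp [integral_cos]

theorem kestenMcKayKernel_zero (q θ : ℝ) :
    kestenMcKayKernel q 0 θ =
      (q + 1) * (Real.sin θ ^ 2 / ((q - 1) ^ 2 + 4 * q * Real.sin θ ^ 2)) := by
  have h : ((0 : ℕ) - 1 : ℝ) * θ = -θ := by push_cast; ring
  rw [kestenMcKayKernel, h, Real.sin_neg, Nat.cast_zero, zero_add, one_mul]
  ring

theorem two_cos_mul_kestenMcKayKernel_zero (q θ : ℝ) :
    q * (2 * Real.cos θ * kestenMcKayKernel q 0 θ) = (q + 1) * kestenMcKayKernel q 1 θ := by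
  have h : ((1 : ℕ) + 1 : ℝ) * θ = 2 * θ := by push_cast; ring
  have h' : ((1 : ℕ) - 1 : ℝ) * θ = 0 := by push_cast; ring
  rw [kestenMcKayKernel_zero, kestenMcKayKernel, h, h', Real.sin_two_mul, Real.sin_zero]
  ring

theorem two_cos_mul_kestenMcKayKernel_succ (q : ℝ) (r : ℕ) (θ : ℝ) :
    2 * Real.cos θ * kestenMcKayKernel q (r + 1) θ =
      kestenMcKayKernel q (r + 2) θ + kestenMcKayKernel q r θ := by
  have key (x : ℝ) : Real.sin (x + θ) + Real.sin (x - θ) = 2 * Real.cos θ * Real.sin x := by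
    rw [Real.sin_add, Real.sin_sub]; ring
  have h₁ := key ((r + 2) * θ)
  have h₂ := key (r * θ)
  simp only [kestenMcKayKernel]
  rw [← mul_div_assoc, ← add_div]
  congr 1
  push_cast
  rw [show ((r : ℝ) + 1 + 1) * θ = (r + 2) * θ by ring,
    show ((r : ℝ) + 1 - 1) * θ = r * θ by ring,
    show ((r : ℝ) + 2 + 1) * θ = (r + 2) * θ + θ by ring,
    show ((r : ℝ) + 2 - 1) * θ = r * θ + θ by ring,
    show ((r : ℝ) + 1) * θ = (r + 2) * θ - θ by ring,
    show ((r : ℝ) - 1) * θ = r * θ - θ by ring]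
  linear_combination Real.sin θ * h₂ - q * Real.sin θ * h₁

theorem kestenMcKayKernel_add_two {q : ℝ} (r : ℕ) {θ : ℝ}
    (hD : (q - 1) ^ 2 + 4 * q * Real.sin θ ^ 2 ≠ 0) :
    kestenMcKayKernel q (r + 2) θ = q * kestenMcKayKernel q r θ -
      (Real.cos (r * θ) - Real.cos ((r + 2 : ℕ) * θ)) / 2 := by
  have h₁ : Real.sin (((r + 2 : ℕ) + 1 : ℝ) * θ) + Real.sin ((r - 1) * θ) =
      2 * (1 - 2 * Real.sin θ ^ 2) * Real.sin ((r + 1) * θ) := by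
    push_cast
    rw [show ((r : ℝ) + 2 + 1) * θ = (r + 1) * θ + 2 * θ by ring,
      show ((r : ℝ) - 1) * θ = (r + 1) * θ - 2 * θ by ring, Real.sin_add, Real.sin_sub,
      ← Real.cos_two_mul_eq_one_sub]
    ring
  have h₂ : Real.cos (r * θ) - Real.cos ((r + 2 : ℕ) * θ) =
      2 * Real.sin θ * Real.sin ((r + 1) * θ) := by
    push_cast
    rw [show (r : ℝ) * θ = (r + 1) * θ - θ by ring,
      show ((r : ℝ) + 2) * θ = (r + 1) * θ + θ by ring, Real.cos_add, Real.cos_sub]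
    ring
  have h₃ : ((r + 2 : ℕ) - 1 : ℝ) * θ = (r + 1) * θ := by push_cast; ring
  rw [h₂]
  simp only [kestenMcKayKernel]
  rw [h₃]
  rw [div_eq_iff hD]
  linear_combination q * Real.sin θ * h₁ - q * div_mul_cancel₀
    (Real.sin θ * (q * Real.sin ((r + 1) * θ) - Real.sin ((r - 1) * θ))) hD

theorem continuous_kestenMcKayKernel {q : ℝ} (hq : 1 < q) (r : ℕ) :
    Continuous (kestenMcKayKernel q r) := by
  have hD (θ : ℝ) : (q - 1) ^ 2 + 4 * q * Real.sin θ ^ 2 ≠ 0 := by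
    have : 0 < q - 1 := by linarith
    positivity
  unfold kestenMcKayKernel
  fun_prop (disch := exact hD _)

theorem abs_kestenMcKayKernel_le {q : ℝ} (hq : 1 < q) (r : ℕ) (θ : ℝ) :
    |kestenMcKayKernel q r θ| ≤ (q + 1) / (q - 1) ^ 2 := by
  have hq' : 0 < q - 1 := by linarith
  rw [kestenMcKayKernel, abs_div, abs_of_pos (a := (q - 1) ^ 2 + _) (by positivity)]
  gcongr
  · rw [abs_mul]
    calc _ ≤ 1 * |q * Real.sin ((r + 1) * θ) - Real.sin ((r - 1) * θ)| := by
          gcongr; exact Real.abs_sin_le_one θ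
      _ ≤ |q * Real.sin ((r + 1) * θ)| + |Real.sin ((r - 1) * θ)| := by
          rw [one_mul]; exact abs_sub _ _
      _ ≤ q * 1 + 1 := by
          rw [abs_mul, abs_of_pos (by linarith : 0 < q)]
          gcongr <;> exact Real.abs_sin_le_one _
      _ = q + 1 := by ring
  · have : 0 ≤ 4 * q * Real.sin θ ^ 2 := by positivity
    linarith

theorem integral_kestenMcKayKernel_add_two {q : ℝ} (hq : 1 < q) (r : ℕ) :
    ∫ θ in 0..Real.pi, kestenMcKayKernel q (r + 2) θ =
      q * (∫ θ in 0..Real.pi, kestenMcKayKernel q r θ) - (if r = 0 then Real.pi else 0) / 2 := by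
  have hD (θ : ℝ) : (q - 1) ^ 2 + 4 * q * Real.sin θ ^ 2 ≠ 0 := by
    have : 0 < q - 1 := by linarith
    positivity
  have hc := continuous_kestenMcKayKernel hq r
  have hcos (n : ℕ) : Continuous fun θ : ℝ => Real.cos (n * θ) := by fun_prop
  simp_rw [kestenMcKayKernel_add_two r (hD _)]
  rw [intervalIntegral.integral_sub ((hc.const_mul q).intervalIntegrable _ _)
      (Continuous.intervalIntegrable (by fun_prop) _ _),
    intervalIntegral.integral_const_mul, intervalIntegral.integral_div,
    intervalIntegral.integral_sub ((hcos r).intervalIntegrable _ _)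
      ((hcos (r + 2)).intervalIntegrable _ _),
    integral_cos_natCast_mul, integral_cos_natCast_mul]
  simp

theorem integral_kestenMcKayKernel_succ {q : ℝ} (hq : 1 < q) (r : ℕ) :
    ∫ θ in 0..Real.pi, kestenMcKayKernel q (r + 1) θ = 0 := by
  set L : ℕ → ℝ := fun r => ∫ θ in 0..Real.pi, kestenMcKayKernel q r θ with hL
  have hrec (j : ℕ) : L (r + 1 + 2 * j) = q ^ j * L (r + 1) := by
    induction j with
    | zero => simp
    | succ j ih =>
      have := integral_kestenMcKayKernel_add_two hq (r + 1 + 2 * j)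
      rw [if_neg (by omega)] at this
      change L (r + 1 + 2 * j + 2) = q * L (r + 1 + 2 * j) - 0 / 2 at this
      rw [show r + 1 + 2 * (j + 1) = r + 1 + 2 * j + 2 by ring, this, ih]
      ring
  have hbd (n : ℕ) : |L n| ≤ (q + 1) / (q - 1) ^ 2 * Real.pi := by
    have := intervalIntegral.norm_integral_le_of_norm_le_const (a := 0) (b := Real.pi)
      (f := kestenMcKayKernel q n) fun θ _ => abs_kestenMcKayKernel_le hq n θ
    rwa [sub_zero, abs_of_pos Real.pi_pos] at this
  by_contra hne
  change L (r + 1) ≠ 0 at hne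
  have hpos := abs_pos.2 hne
  obtain ⟨j, hj⟩ := pow_unbounded_of_one_lt ((q + 1) / (q - 1) ^ 2 * Real.pi / |L (r + 1)|) hq
  have h := hbd (r + 1 + 2 * j)
  rw [hrec, abs_mul, abs_of_pos (by positivity)] at h
  rw [div_lt_iff₀ hpos] at hj
  linarith

theorem integral_kestenMcKayKernel {q : ℝ} (hq : 1 ≤ q) (r : ℕ) :
    ∫ θ in 0..Real.pi, kestenMcKayKernel q r θ = if r = 0 then Real.pi / (2 * q) else 0 := by
  rcases hq.eq_or_lt with rfl | hq
  · have h : ∫ θ in 0..Real.pi, kestenMcKayKernel 1 r θ =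
        ∫ θ in 0..Real.pi, Real.cos (r * θ) / 2 := by
      simp_rw [intervalIntegral.integral_of_le Real.pi_pos.le, integral_Ioc_eq_integral_Ioo]
      refine setIntegral_congr_fun measurableSet_Ioo fun θ hθ => ?_
      have hs : Real.sin θ ≠ 0 := (Real.sin_pos_of_mem_Ioo hθ).ne'
      have h : Real.sin ((r + 1) * θ) - Real.sin ((r - 1) * θ) =
          2 * Real.sin θ * Real.cos (r * θ) := by
        rw [add_one_mul, sub_one_mul, Real.sin_add, Real.sin_sub]
        ring
      simp only [kestenMcKayKernel, one_mul, h]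
      field_simp
      ring
    rw [h, intervalIntegral.integral_div, integral_cos_natCast_mul]
    split_ifs <;> ring
  · cases r with
    | zero =>
      have h := integral_kestenMcKayKernel_add_two hq 0
      rw [integral_kestenMcKayKernel_succ hq 1] at h
      simp only [if_true] at h ⊢
      field_simp
      linarith
    | succ r => simpa using integral_kestenMcKayKernel_succ hq r

theorem abs_kestenMcKayKernel_zero_le {q : ℝ} (hq : 1 ≤ q) (θ : ℝ) :
    |kestenMcKayKernel q 0 θ| ≤ q + 1 := by
  have hs : 0 ≤ Real.sin θ ^ 2 := sq_nonneg _
  rw [kestenMcKayKernel_zero, abs_of_nonneg (by positivity)]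
  refine mul_le_of_le_one_right (by positivity) (div_le_one_of_le₀ ?_ (by positivity))
  nlinarith [sq_nonneg (q - 1)]

theorem measurable_kestenMcKayKernel (q : ℝ) (r : ℕ) : Measurable (kestenMcKayKernel q r) := by
  unfold kestenMcKayKernel
  fun_prop

theorem intervalIntegrable_kestenMcKayKernel {q : ℝ} (hq : 1 ≤ q) (r : ℕ) (a b : ℝ) :
    IntervalIntegrable (kestenMcKayKernel q r) volume a b := by
  have hcos : ContinuousOn (fun θ : ℝ => 2 * Real.cos θ) (Set.uIcc a b) := by fun_prop
  have h0 : IntervalIntegrable (kestenMcKayKernel q 0) volume a b := by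
    refine (intervalIntegrable_const (c := q + 1)).mono_fun
      (measurable_kestenMcKayKernel q 0).aestronglyMeasurable (ae_of_all _ fun θ => ?_)
    simp only [Real.norm_eq_abs]
    exact (abs_kestenMcKayKernel_zero_le hq θ).trans (le_abs_self _)
  induction r using Nat.twoStepInduction with
  | zero => exact h0
  | one =>
    convert! (h0.continuousOn_mul hcos).const_mul (q / (q + 1)) using 1
    ext θ
    have := two_cos_mul_kestenMcKayKernel_zero q θ
    field_simp
    linarith
  | more r h₀ h₁ =>
    convert! (h₁.continuousOn_mul hcos).sub h₀ using 1
    ext θ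
    have := two_cos_mul_kestenMcKayKernel_succ q r θ
    linarith

theorem integral_kestenMcKay_eq {q : ℝ} (hq : 1 ≤ q) (f : ℝ → ℝ) :
    ((q + 1) / (2 * Real.pi)) * ∫ s in (-(2 * Real.sqrt q))..(2 * Real.sqrt q),
        f s * Real.sqrt (4 * q - s ^ 2) / ((q + 1) ^ 2 - s ^ 2) =
      (2 * q / Real.pi) *
        ∫ θ in 0..Real.pi, f (2 * Real.sqrt q * Real.cos θ) * kestenMcKayKernel q 0 θ := by
  have hsub := intervalIntegral.integral_comp_mul_deriv_of_deriv_nonpos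
    (a := 0) (b := Real.pi) (f := fun θ => 2 * Real.sqrt q * Real.cos θ)
    (f' := fun θ => 2 * Real.sqrt q * -Real.sin θ)
    (g := fun s => f s * Real.sqrt (4 * q - s ^ 2) / ((q + 1) ^ 2 - s ^ 2))
    (by fun_prop) (fun θ _ => ((Real.hasDerivAt_cos θ).const_mul _))
    (fun θ hθ => by
      rw [min_eq_left Real.pi_pos.le, max_eq_right Real.pi_pos.le] at hθ
      have := Real.sin_pos_of_mem_Ioo hθ
      have : 0 ≤ 2 * Real.sqrt q * Real.sin θ := by positivity
      linarith)
  simp only [Real.cos_zero, Real.cos_pi, mul_one, mul_neg] at hsub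
  rw [intervalIntegral.integral_symm, ← hsub, ← intervalIntegral.integral_neg,
    ← intervalIntegral.integral_const_mul, ← intervalIntegral.integral_const_mul]
  refine intervalIntegral.integral_congr fun θ hθ => ?_
  rw [Set.uIcc_of_le Real.pi_pos.le] at hθ
  have hs := Real.sin_nonneg_of_mem_Icc hθ
  have hsq : Real.sqrt q ^ 2 = q := Real.sq_sqrt (by linarith)
  have hcs := Real.sin_sq_add_cos_sq θ
  have h₁ : 4 * q - (2 * Real.sqrt q * Real.cos θ) ^ 2 = (2 * Real.sqrt q * Real.sin θ) ^ 2 := by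
    rw [mul_pow, mul_pow, mul_pow, mul_pow, hsq]
    linear_combination -4 * q * hcs
  have h₂ : (q + 1) ^ 2 - (2 * Real.sqrt q * Real.cos θ) ^ 2 =
      (q - 1) ^ 2 + 4 * q * Real.sin θ ^ 2 := by
    rw [mul_pow, mul_pow, hsq]
    linear_combination -4 * q * hcs
  simp only [Function.comp_apply]
  rw [h₁, h₂, Real.sqrt_sq (by positivity), kestenMcKayKernel_zero]
  have hpi := Real.pi_ne_zero
  field_simp
  rw [hsq]

end KestenMcKay

namespace SimpleGraph

variable {V : Type*} [Fintype V] [DecidableEq V] (G : SimpleGraph V)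

/-- The incidence matrix between vertices and the darts leaving them. -/
def dartFstMatrix : Matrix V G.Dart ℝ := .of fun u e => if e.fst = u then 1 else 0

/-- The incidence matrix between darts and the vertices they enter. -/
def dartSndMatrix : Matrix G.Dart V ℝ := .of fun e v => if e.snd = v then 1 else 0

/-- The permutation matrix of dart reversal. -/
def dartSymmMatrix : Matrix G.Dart G.Dart ℝ := .of fun e f => if f = e.symm then 1 else 0

/-- The non-backtracking (Hashimoto) matrix. -/
def nonBacktrackingMatrix : Matrix G.Dart G.Dart ℝ :=
  G.dartSndMatrix * G.dartFstMatrix - G.dartSymmMatrix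

theorem nonBacktrackingMatrix_nonneg (e f : G.Dart) : 0 ≤ G.nonBacktrackingMatrix e f := by
  simp only [nonBacktrackingMatrix, dartSymmMatrix, Matrix.sub_apply, Matrix.mul_apply,
    dartSndMatrix, dartFstMatrix, Matrix.of_apply]
  by_cases h : f = e.symm <;> simp [h]
  split_ifs <;> norm_num

variable [DecidableRel G.Adj]

/-- For `r ≥ 1` the entries count the non-backtracking walks of length `r`; the value at `0` is
normalised so that the three-term recurrence holds for every `r`. -/
noncomputable def nonBacktrackingWalkMatrix (q : ℝ) : ℕ → Matrix V V ℝ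
  | 0 => ((q + 1) / q) • 1
  | r + 1 => G.dartFstMatrix * G.nonBacktrackingMatrix ^ r * G.dartSndMatrix

theorem dartFstMatrix_mul_dartSndMatrix :
    G.dartFstMatrix * G.dartSndMatrix = G.adjMatrix ℝ := by
  ext u v
  simp only [Matrix.mul_apply, dartFstMatrix, dartSndMatrix, Matrix.of_apply, adjMatrix_apply,
    ← ite_and, mul_ite, mul_one, mul_zero]
  split_ifs with h
  · rw [Finset.sum_eq_single_of_mem (⟨(u, v), h⟩ : G.Dart) (Finset.mem_univ _)]
    · simp
    · rintro e - he
      refine if_neg fun h' => he ?_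
      ext <;> simp [h'.1, h'.2]
  · refine Finset.sum_eq_zero fun e _ => if_neg ?_
    rintro ⟨rfl, rfl⟩
    exact h e.adj

theorem dartSymmMatrix_mul_self : G.dartSymmMatrix * G.dartSymmMatrix = 1 := by
  ext e f
  simp only [Matrix.mul_apply, dartSymmMatrix, Matrix.of_apply, ite_mul, one_mul, zero_mul]
  rw [Finset.sum_ite_eq' _ e.symm]
  simp [Matrix.one_apply, eq_comm]

theorem dartSymmMatrix_mul_dartSndMatrix :
    G.dartSymmMatrix * G.dartSndMatrix = G.dartFstMatrix.transpose := by
  ext e v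
  simp only [Matrix.mul_apply, dartSymmMatrix, Matrix.of_apply, ite_mul, one_mul, zero_mul]
  rw [Finset.sum_ite_eq' _ e.symm]
  simp [dartSndMatrix, dartFstMatrix]

theorem dartFstMatrix_mul_transpose {d : ℕ} (hreg : G.IsRegularOfDegree d) :
    G.dartFstMatrix * G.dartFstMatrix.transpose = (d : ℝ) • 1 := by
  ext u v
  rcases eq_or_ne u v with rfl | huv
  · have h := G.dart_fst_fiber_card_eq_degree u
    rw [hreg.degree_eq u] at h
    simp [Matrix.mul_apply, dartFstMatrix, ← ite_and, h]
  · rw [Matrix.smul_apply, Matrix.one_apply_ne huv, smul_zero, Matrix.mul_apply]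
    refine Finset.sum_eq_zero fun e _ => ?_
    simp only [dartFstMatrix, Matrix.of_apply, Matrix.transpose_apply]
    split_ifs <;> simp_all

theorem nonBacktrackingWalkMatrix_nonneg {q : ℝ} (hq : 0 ≤ q) (r : ℕ) (u v : V) :
    0 ≤ G.nonBacktrackingWalkMatrix q r u v := by
  cases r with
  | zero =>
    simp only [nonBacktrackingWalkMatrix, Matrix.smul_apply, Matrix.one_apply, smul_eq_mul]
    split_ifs <;> positivity
  | succ r =>
    have hpow (e f : G.Dart) : 0 ≤ (G.nonBacktrackingMatrix ^ r) e f := by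
      induction r generalizing e f with
      | zero => rw [pow_zero, Matrix.one_apply]; split_ifs <;> norm_num
      | succ r ih =>
        rw [pow_succ, Matrix.mul_apply]
        exact Finset.sum_nonneg fun i _ => mul_nonneg (ih _ _) (G.nonBacktrackingMatrix_nonneg _ _)
    simp only [nonBacktrackingWalkMatrix, Matrix.mul_apply, dartFstMatrix, dartSndMatrix,
      Matrix.of_apply]
    refine Finset.sum_nonneg fun i _ => mul_nonneg (Finset.sum_nonneg fun j _ =>
      mul_nonneg ?_ (hpow _ _)) ?_ <;> split_ifs <;> norm_num

theorem nonBacktrackingWalkMatrix_zero_mul_adjMatrix (q : ℝ) :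
    G.nonBacktrackingWalkMatrix q 0 * G.adjMatrix ℝ =
      ((q + 1) / q) • G.nonBacktrackingWalkMatrix q 1 := by
  simp [nonBacktrackingWalkMatrix, dartFstMatrix_mul_dartSndMatrix]

theorem nonBacktrackingWalkMatrix_succ_mul_adjMatrix {q : ℕ} (hq : q ≠ 0)
    (hreg : G.IsRegularOfDegree (q + 1)) (r : ℕ) :
    G.nonBacktrackingWalkMatrix q (r + 1) * G.adjMatrix ℝ =
      G.nonBacktrackingWalkMatrix q (r + 2) + (q : ℝ) • G.nonBacktrackingWalkMatrix q r := by
  have hq' : (q : ℝ) ≠ 0 := by exact_mod_cast hq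
  have hTA : G.dartSndMatrix * G.adjMatrix ℝ =
      G.nonBacktrackingMatrix * G.dartSndMatrix + G.dartFstMatrix.transpose := by
    rw [nonBacktrackingMatrix, Matrix.sub_mul, dartSymmMatrix_mul_dartSndMatrix, sub_add_cancel,
      Matrix.mul_assoc, dartFstMatrix_mul_dartSndMatrix]
  have hBS : G.nonBacktrackingMatrix * G.dartFstMatrix.transpose = (q : ℝ) • G.dartSndMatrix := by
    rw [nonBacktrackingMatrix, Matrix.sub_mul, Matrix.mul_assoc,
      G.dartFstMatrix_mul_transpose hreg, ← dartSymmMatrix_mul_dartSndMatrix, ← Matrix.mul_assoc,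
      dartSymmMatrix_mul_self, Matrix.one_mul, Matrix.mul_smul, Matrix.mul_one]
    push_cast
    rw [add_smul, one_smul, add_sub_cancel_right]
  have hmain : G.nonBacktrackingWalkMatrix q (r + 1) * G.adjMatrix ℝ =
      G.nonBacktrackingWalkMatrix q (r + 2) +
        G.dartFstMatrix * G.nonBacktrackingMatrix ^ r * G.dartFstMatrix.transpose := by
    simp only [nonBacktrackingWalkMatrix]
    rw [Matrix.mul_assoc, hTA, Matrix.mul_add, pow_succ]
    simp only [Matrix.mul_assoc]
  rw [hmain]
  congr 1
  cases r with
  | zero =>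
    rw [pow_zero, Matrix.mul_one, G.dartFstMatrix_mul_transpose hreg, nonBacktrackingWalkMatrix,
      smul_smul, mul_div_cancel₀ _ hq']
    push_cast
    rfl
  | succ r =>
    simp only [nonBacktrackingWalkMatrix]
    rw [pow_succ, ← Matrix.mul_assoc, Matrix.mul_assoc, hBS, Matrix.mul_smul]

/-- The diagonal of `A ^ k`, multiplied by a non-backtracking walk matrix, dominates the
corresponding quantity for the regular tree. -/
theorem integral_le_nonBacktrackingWalkMatrix_mul_pow {q : ℕ} (hq : 1 ≤ q)
    (hreg : G.IsRegularOfDegree (q + 1)) (v : V) (k r : ℕ) :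
    (2 * (q + 1) / Real.pi) * ∫ θ in 0..Real.pi, (2 * Real.sqrt q * Real.cos θ) ^ k *
        (Real.sqrt q ^ r * kestenMcKayKernel q r θ) ≤
      (G.nonBacktrackingWalkMatrix q r * G.adjMatrix ℝ ^ k) v v := by
  have hq' : (1 : ℝ) ≤ q := by exact_mod_cast hq
  have hsq : Real.sqrt q ^ 2 = (q : ℝ) := Real.sq_sqrt (by positivity)
  have hpi := Real.pi_pos
  have hint (k r : ℕ) : IntervalIntegrable (fun θ => (2 * Real.sqrt q * Real.cos θ) ^ k *
      (Real.sqrt q ^ r * kestenMcKayKernel q r θ)) volume 0 Real.pi :=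
    ((intervalIntegrable_kestenMcKayKernel hq' r _ _).const_mul _).continuousOn_mul (by fun_prop)
  induction k generalizing r with
  | zero =>
    simp only [pow_zero, one_mul, mul_one, intervalIntegral.integral_const_mul,
      integral_kestenMcKayKernel hq']
    split_ifs with hr
    · subst hr
      simp only [nonBacktrackingWalkMatrix, Matrix.smul_apply, Matrix.one_apply_eq, smul_eq_mul]
      apply le_of_eq
      field_simp
    · simpa using G.nonBacktrackingWalkMatrix_nonneg (Nat.cast_nonneg q) r v v
  | succ k ih =>
    rw [pow_succ', ← Matrix.mul_assoc]
    cases r with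
    | zero =>
      rw [nonBacktrackingWalkMatrix_zero_mul_adjMatrix, Matrix.smul_mul, Matrix.smul_apply,
        smul_eq_mul]
      refine le_trans (le_of_eq ?_) (mul_le_mul_of_nonneg_left (ih 1) (by positivity))
      rw [mul_left_comm, ← intervalIntegral.integral_const_mul (((q : ℝ) + 1) / q)]
      congr 1
      refine intervalIntegral.integral_congr fun θ _ => ?_
      have := two_cos_mul_kestenMcKayKernel_zero q θ
      have h : 2 * Real.cos θ * kestenMcKayKernel q 0 θ =
          ((q : ℝ) + 1) / q * kestenMcKayKernel q 1 θ := by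
        field_simp
        linear_combination this
      linear_combination (2 * Real.sqrt q * Real.cos θ) ^ k * Real.sqrt q * h
    | succ r =>
      rw [G.nonBacktrackingWalkMatrix_succ_mul_adjMatrix (by omega) hreg, Matrix.add_mul,
        Matrix.smul_mul, Matrix.add_apply, Matrix.smul_apply, smul_eq_mul]
      refine le_trans (le_of_eq ?_)
        (add_le_add (ih (r + 2)) (mul_le_mul_of_nonneg_left (ih r) (Nat.cast_nonneg q)))
      rw [mul_left_comm (q : ℝ), ← mul_add, ← intervalIntegral.integral_const_mul (q : ℝ),
        ← intervalIntegral.integral_add (hint _ _) ((hint _ _).const_mul _)]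
      congr 1
      refine intervalIntegral.integral_congr fun θ _ => ?_
      have := two_cos_mul_kestenMcKayKernel_succ q r θ
      linear_combination (2 * Real.sqrt q * Real.cos θ) ^ k * Real.sqrt q ^ (r + 2) * this +
        (2 * Real.sqrt q * Real.cos θ) ^ k * Real.sqrt q ^ r * kestenMcKayKernel q r θ * hsq

theorem integral_le_adjMatrix_pow_apply_self {q : ℕ} (hq : 1 ≤ q)
    (hreg : G.IsRegularOfDegree (q + 1)) (v : V) (k : ℕ) :
    (2 * q / Real.pi) * ∫ θ in 0..Real.pi,
        (2 * Real.sqrt q * Real.cos θ) ^ k * kestenMcKayKernel q 0 θ ≤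
      (G.adjMatrix ℝ ^ k) v v := by
  have hq' : (0 : ℝ) < q := by exact_mod_cast hq
  have h := G.integral_le_nonBacktrackingWalkMatrix_mul_pow hq hreg v k 0
  have hM : (G.nonBacktrackingWalkMatrix q 0 * G.adjMatrix ℝ ^ k) v v =
      (q + 1) * (G.adjMatrix ℝ ^ k) v v / q := by
    rw [nonBacktrackingWalkMatrix, Matrix.smul_mul, Matrix.one_mul, Matrix.smul_apply,
      smul_eq_mul, div_mul_eq_mul_div]
  simp only [pow_zero, one_mul] at h
  rw [hM, le_div_iff₀' hq'] at h
  refine le_of_mul_le_mul_left (le_trans (le_of_eq ?_) h) (by positivity : (0 : ℝ) < q + 1)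
  ring

end SimpleGraph

theorem Matrix.IsHermitian.trace_pow_eq_sum_eigenvalues {n : Type*} [Fintype n] [DecidableEq n]
    {A : Matrix n n ℝ} (hA : A.IsHermitian) (k : ℕ) :
    (A ^ k).trace = ∑ i, hA.eigenvalues i ^ k := by
  conv_lhs => rw [hA.spectral_theorem]
  rw [← map_pow, Unitary.conjStarAlgAut_apply, Matrix.trace_mul_cycle, Unitary.coe_star_mul_self,
    Matrix.one_mul, Matrix.diagonal_pow, Matrix.trace_diagonal]
  simp

theorem Real.hasSum_pow_div_factorial (x : ℝ) :
    HasSum (fun k : ℕ => x ^ k / k.factorial) (Real.exp x) := by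
  rw [Real.exp_eq_exp_ℝ]
  exact NormedSpace.expSeries_div_hasSum_exp x

theorem hasSum_integral_exp_kestenMcKayKernel {q : ℝ} (hq : 1 ≤ q) (t : ℝ) :
    HasSum (fun k : ℕ => t ^ k / k.factorial * ∫ θ in 0..Real.pi,
        (2 * Real.sqrt q * Real.cos θ) ^ k * kestenMcKayKernel q 0 θ)
      (∫ θ in 0..Real.pi,
        Real.exp (2 * Real.sqrt q * Real.cos θ * t) * kestenMcKayKernel q 0 θ) := by
  simp_rw [← intervalIntegral.integral_const_mul]
  have hb := (Real.hasSum_pow_div_factorial (2 * Real.sqrt q * |t|)).mul_right (q + 1)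
  refine intervalIntegral.hasSum_integral_of_dominated_convergence
    (fun k _ => (2 * Real.sqrt q * |t|) ^ k / k.factorial * (q + 1)) (fun k => ?_) (fun k => ?_)
    (ae_of_all _ fun θ _ => hb.summable) intervalIntegrable_const (ae_of_all _ fun θ _ => ?_)
  · have := measurable_kestenMcKayKernel q 0
    exact Measurable.aestronglyMeasurable (by fun_prop)
  · refine ae_of_all _ fun θ _ => ?_
    rw [← mul_assoc, norm_mul]
    gcongr
    · rw [div_mul_eq_mul_div, ← mul_pow, norm_div, norm_pow, Real.norm_natCast]
      gcongr
      rw [Real.norm_eq_abs, abs_mul, abs_mul, abs_of_nonneg (a := 2 * Real.sqrt q) (by positivity),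
        mul_comm |t|]
      refine mul_le_mul_of_nonneg_right ?_ (abs_nonneg t)
      exact mul_le_of_le_one_right (by positivity) (Real.abs_cos_le_one θ)
    · exact abs_kestenMcKayKernel_zero_le hq θ
  · convert! (Real.hasSum_pow_div_factorial (2 * Real.sqrt q * Real.cos θ * t)).mul_right
      (kestenMcKayKernel q 0 θ) using 1
    ext k
    ring


/-- For a finite simple `(q+1)`-regular graph `G` on `n ≥ 1` vertices
with adjacency eigenvalues `λ_1, …, λ_n`, and every real `t > 0`,
`(1/n) ∑ e^{t λ_i} ≥ ((q+1)/(2π)) ∫_{-2√q}^{2√q} e^{st} √(4q - s²)/((q+1)² - s²) ds`. -/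
theorem mean_exp_eigenvalues_ge_main_term
    {V : Type*} [Fintype V] [DecidableEq V]
    (q : ℕ) (hq : 1 ≤ q)
    (G : SimpleGraph V) [DecidableRel G.Adj]
    (hn : 1 ≤ Fintype.card V)
    (hreg : G.IsRegularOfDegree (q + 1))
    (hA : (G.adjMatrix ℝ).IsHermitian)
    (t : ℝ) (ht : 0 < t) :
    (1 / (Fintype.card V : ℝ)) * ∑ i, Real.exp (t * hA.eigenvalues i) ≥
      ((q + 1 : ℝ) / (2 * Real.pi)) *
        ∫ s in (-(2 * Real.sqrt q))..(2 * Real.sqrt q),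
          Real.exp (s * t) * Real.sqrt (4 * q - s ^ 2) / ((q + 1 : ℝ) ^ 2 - s ^ 2) := by
  have hq' : (1 : ℝ) ≤ q := by exact_mod_cast hq
  have hcard : (0 : ℝ) < Fintype.card V := by exact_mod_cast hn
  rw [ge_iff_le, integral_kestenMcKay_eq hq' fun s => Real.exp (s * t)]
  refine hasSum_le (fun k => ?_) ((hasSum_integral_exp_kestenMcKayKernel hq' t).mul_left _)
    ((hasSum_sum fun i _ => Real.hasSum_pow_div_factorial (t * hA.eigenvalues i)).mul_left _)
  have htr : (Fintype.card V : ℝ) * ((2 * q / Real.pi) * ∫ θ in 0..Real.pi,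
      (2 * Real.sqrt q * Real.cos θ) ^ k * kestenMcKayKernel q 0 θ) ≤
        ∑ i, hA.eigenvalues i ^ k := by
    rw [← hA.trace_pow_eq_sum_eigenvalues, ← nsmul_eq_mul, Matrix.trace]
    exact Finset.card_nsmul_le_sum _ _ _ fun v _ =>
      G.integral_le_adjMatrix_pow_apply_self hq hreg v k
  have hsum : ∑ i, (t * hA.eigenvalues i) ^ k / k.factorial =
      t ^ k / k.factorial * ∑ i, hA.eigenvalues i ^ k := by
    rw [Finset.mul_sum]
    exact Finset.sum_congr rfl fun i _ => by ring
  rw [hsum, mul_left_comm, mul_left_comm (1 / (Fintype.card V : ℝ))]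
  refine mul_le_mul_of_nonneg_left ?_ (by positivity)
  rw [one_div_mul_eq_div, le_div_iff₀' hcard]
  exact htr
end

section
/- Let G be a finite simple 3-regular (cubic) graph on n ≥ 1 vertices with adjacency-matrix eigenvalues λ_1, …, λ_n, and set μ = (1/n)·∑_{i=1}^n e^{λ_i/3}. Then μ ≥ J(1/3), where J(t) = (3/(2π)) · ∫_{−2√2}^{2√2} e^{s·t} · √(8 − s²)/(9 − s²) ds. -/
/-- The main term `J(t)` of the Ihara-Selberg trace formula for cubic graphs:
`J(t) = (3/(2π)) ∫_{-2√2}^{2√2} e^{st} √(8 - s²)/(9 - s²) ds`. -/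
noncomputable def iharaSelbergMainTerm (t : ℝ) : ℝ :=
  (3 / (2 * Real.pi)) *
    ∫ s in (-(2 * Real.sqrt 2))..(2 * Real.sqrt 2),
      Real.exp (s * t) * Real.sqrt (8 - s ^ 2) / (9 - s ^ 2)

open Real MeasureTheory

/-- The polynomials with `nonBacktracking A k` counting the non-backtracking walks of length `k` in
a cubic graph with adjacency matrix `A`. -/
def nonBacktracking {R : Type*} [Ring R] (x : R) : ℕ → R
  | 0 => 1
  | 1 => x
  | 2 => x * x - 3
  | k + 3 => x * nonBacktracking x (k + 2) - 2 * nonBacktracking x (k + 1)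

/-- The constant `c k` in `x * F k = F (k + 1) + c k * F (k - 1)`. -/
def nonBacktrackingCoeff : ℕ → ℕ
  | 0 => 0
  | 1 => 3
  | _ + 2 => 2

theorem mul_nonBacktracking {R : Type*} [Ring R] (x : R) (k : ℕ) :
    x * nonBacktracking x k =
      nonBacktracking x (k + 1) + nonBacktrackingCoeff k • nonBacktracking x (k - 1) := by
  match k with
  | 0 => simp [nonBacktracking, nonBacktrackingCoeff]
  | 1 => simp [nonBacktracking, nonBacktrackingCoeff]
  | k + 2 => simp [nonBacktracking, nonBacktrackingCoeff, two_mul]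

theorem continuous_nonBacktracking (k : ℕ) :
    Continuous fun x : ℝ => nonBacktracking x k := by
  induction k using nonBacktracking.induct with
  | case1 => simpa [nonBacktracking] using continuous_const
  | case2 => simpa [nonBacktracking] using continuous_id'
  | case3 => simp only [nonBacktracking]; fun_prop
  | case4 k h1 h2 => simp only [nonBacktracking]; fun_prop

theorem nonBacktracking_two_sqrt_two_mul_cos_mul_sin (θ : ℝ) (k : ℕ) :
    nonBacktracking (2 * √2 * cos θ) (k + 1) * sin θ =
      √2 ^ (k + 1) * (sin ((k + 2) * θ) - sin (k * θ) / 2) := by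
  have h2 : √2 * √2 = 2 := Real.mul_self_sqrt (by norm_num)
  induction k using Nat.twoStepInduction with
  | zero => simp [nonBacktracking, sin_two_mul]; ring
  | one =>
    have : sin ((1 + 2) * θ) = 3 * sin θ - 4 * sin θ ^ 3 := by
      rw [← sin_three_mul]; norm_num
    simp only [nonBacktracking, Nat.cast_one, this, one_mul]
    have hs : sin θ ^ 3 = sin θ * (1 - cos θ ^ 2) := by rw [← sin_sq]; ring
    rw [hs]
    linear_combination (4 * cos θ ^ 2 * sin θ - (5 / 2) * sin θ - 4 * sin θ * (cos θ^2 - 1)) * h2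
  | more k h0 h1 =>
    have e : nonBacktracking (2 * √2 * cos θ) (k + 2 + 1) = (2 * √2 * cos θ) *
        nonBacktracking (2 * √2 * cos θ) (k + 1 + 1)
        - 2 * nonBacktracking (2 * √2 * cos θ) (k + 1) := rfl
    have s (y : ℝ) : sin ((y + 2) * θ) = 2 * cos θ * sin ((y + 1) * θ) - sin (y * θ) := by
      have a : (y + 2) * θ = (y + 1) * θ + θ := by ring
      have b : y * θ = (y + 1) * θ - θ := by ring
      rw [a, b, sin_add, sin_sub]; ring
    have s0 := s k
    have s2 := s (k + 2)
    push_cast at h1 ⊢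
    rw [show (k : ℝ) + 1 + 2 = k + 2 + 1 by ring] at h1
    rw [e, s2, s0]
    rw [s0] at h0
    have p1 : √2 ^ (k + 1 + 1) = √2 ^ (k + 1) * √2 := pow_succ _ _
    have p2 : √2 ^ (k + 2 + 1) = √2 ^ (k + 1) * 2 := by
      rw [show k + 2 + 1 = (k + 1) + 1 + 1 by ring, pow_succ, pow_succ, mul_assoc, h2]
    rw [p1] at h1
    rw [p2]
    linear_combination (2 * √2 * cos θ) * h1 - 2 * h0 + 2 * cos θ * √2 ^ (k + 1) *
      (sin ((k + 2 + 1) * θ) - sin ((k + 1) * θ) / 2) * h2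

/-- The Fourier coefficients of the Poisson kernel `1 / (5 - 4 cos (2θ))`. -/
noncomputable def poissonCoeff (y : ℝ) : ℝ :=
  ∫ θ in (0 : ℝ)..π, cos (y * θ) / (5 - 4 * cos (2 * θ))

theorem one_le_poissonDenom (θ : ℝ) : 1 ≤ 5 - 4 * cos (2 * θ) := by
  linarith [cos_le_one (2 * θ)]

theorem poissonDenom_ne_zero (θ : ℝ) : 5 - 4 * cos (2 * θ) ≠ 0 := by
  linarith [one_le_poissonDenom θ]

theorem intervalIntegrable_poissonCoeff (y : ℝ) :
    IntervalIntegrable (fun θ => cos (y * θ) / (5 - 4 * cos (2 * θ))) volume 0 π :=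
  Continuous.intervalIntegrable (by fun_prop (disch := exact poissonDenom_ne_zero)) _ _

theorem abs_poissonCoeff_le (y : ℝ) : |poissonCoeff y| ≤ π := by
  have h := intervalIntegral.norm_integral_le_of_norm_le_const (a := 0) (b := π) (C := 1)
    (f := fun θ => cos (y * θ) / (5 - 4 * cos (2 * θ))) (fun θ _ => by
      have h1 := one_le_poissonDenom θ
      rw [Real.norm_eq_abs, abs_div, abs_of_pos (by linarith : 0 < 5 - 4 * cos (2 * θ)),
        div_le_one (by linarith)]
      exact (abs_cos_le_one _).trans h1)
  simpa [poissonCoeff, abs_of_pos pi_pos] using h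

theorem poissonCoeff_neg (y : ℝ) : poissonCoeff (-y) = poissonCoeff y := by
  simp [poissonCoeff]

theorem poissonCoeff_recurrence (y : ℝ) :
    5 * poissonCoeff y - 2 * poissonCoeff (y + 2) - 2 * poissonCoeff (y - 2) =
      ∫ θ in (0 : ℝ)..π, cos (y * θ) := by
  simp only [poissonCoeff]
  rw [← intervalIntegral.integral_const_mul, ← intervalIntegral.integral_const_mul,
    ← intervalIntegral.integral_const_mul, ← intervalIntegral.integral_sub
      ((intervalIntegrable_poissonCoeff _).const_mul _)
      ((intervalIntegrable_poissonCoeff _).const_mul _),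
    ← intervalIntegral.integral_sub
      (((intervalIntegrable_poissonCoeff _).const_mul _).sub
        ((intervalIntegrable_poissonCoeff _).const_mul _))
      ((intervalIntegrable_poissonCoeff _).const_mul _)]
  congr 1 with θ
  have := poissonDenom_ne_zero θ
  have hs : cos ((y + 2) * θ) + cos ((y - 2) * θ) = 2 * cos (y * θ) * cos (2 * θ) := by
    rw [add_mul, sub_mul, cos_add, cos_sub]
    ring
  rw [← mul_div_assoc, ← mul_div_assoc, ← mul_div_assoc, ← sub_div, ← sub_div, div_eq_iff this]
  linear_combination -2 * hs

theorem poissonCoeff_add_two_of_nat (k : ℕ) :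
    poissonCoeff (k + 1) = poissonCoeff (k - 1) / 2 := by
  set D : ℕ → ℝ := fun k => poissonCoeff (k + 1) - poissonCoeff (k - 1) / 2 with hD
  have step (k : ℕ) : D (k + 2) = 2 * D k := by
    have h := poissonCoeff_recurrence (k + 1)
    have hk : (k : ℝ) + 1 ≠ 0 := by positivity
    have hs : sin ((k + 1) * π) = 0 := by exact_mod_cast sin_nat_mul_pi (k + 1)
    rw [intervalIntegral.integral_comp_mul_left _ hk, integral_cos, hs] at h
    have e1 : (k : ℝ) + 1 + 2 = k + 2 + 1 := by ring
    have e2 : (k : ℝ) + 1 - 2 = k - 1 := by ring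
    have e3 : (k : ℝ) + 2 - 1 = k + 1 := by ring
    simp only [e1, e2, mul_zero, sin_zero, sub_zero, smul_zero] at h
    simp only [hD]
    push_cast
    rw [e3]
    linarith
  have pow_step (j : ℕ) : D (k + 2 * j) = 2 ^ j * D k := by
    induction j with
    | zero => simp
    | succ j ih => rw [show k + 2 * (j + 1) = k + 2 * j + 2 by ring, step, ih]; ring
  have bound (k : ℕ) : |D k| ≤ 2 * π := by
    have h1 := abs_le.1 (abs_poissonCoeff_le (k + 1))
    have h2 := abs_le.1 (abs_poissonCoeff_le (k - 1))
    have := pi_pos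
    rw [abs_le]
    constructor <;> simp only [hD] <;> linarith [h1.1, h1.2, h2.1, h2.2]
  by_contra hne
  have hpos : 0 < |D k| := abs_pos.2 (sub_ne_zero.2 hne)
  obtain ⟨j, hj⟩ := pow_unbounded_of_one_lt (2 * π / |D k|) (by norm_num : (1 : ℝ) < 2)
  rw [div_lt_iff₀ hpos] at hj
  have := bound (k + 2 * j)
  rw [pow_step, abs_mul, abs_of_pos (by positivity)] at this
  linarith

theorem poissonCoeff_zero : poissonCoeff 0 = π / 3 := by
  have h := poissonCoeff_recurrence 0
  have h1 := poissonCoeff_add_two_of_nat 1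
  norm_num [poissonCoeff_neg] at h h1
  rw [h1] at h
  linarith

/-- The density of the Kesten-McKay law in the coordinate `s = 2√2 cos θ`, up to the factor
`3 / (2π)`. -/
noncomputable def kestenMcKayWeight (θ : ℝ) : ℝ :=
  8 * sin θ ^ 2 / (9 - 8 * cos θ ^ 2)

theorem kestenMcKayWeight_eq (θ : ℝ) :
    kestenMcKayWeight θ = 8 * sin θ ^ 2 / (5 - 4 * cos (2 * θ)) := by
  rw [kestenMcKayWeight, cos_two_mul]
  ring_nf

theorem continuous_kestenMcKayWeight : Continuous kestenMcKayWeight := by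
  rw [funext kestenMcKayWeight_eq]
  fun_prop (disch := exact poissonDenom_ne_zero)

/-- Integration against the Kesten-McKay law of the cubic tree. -/
noncomputable def kestenMcKay (f : ℝ → ℝ) : ℝ :=
  3 / (2 * π) * ∫ θ in (0 : ℝ)..π, f (2 * √2 * cos θ) * kestenMcKayWeight θ

theorem kestenMcKay_add {f g : ℝ → ℝ} (hf : Continuous f) (hg : Continuous g) :
    kestenMcKay (fun x => f x + g x) = kestenMcKay f + kestenMcKay g := by
  have := continuous_kestenMcKayWeight
  simp only [kestenMcKay, add_mul]
  rw [intervalIntegral.integral_add, mul_add] <;>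
    exact Continuous.intervalIntegrable (by fun_prop) _ _

theorem kestenMcKay_const_mul (c : ℝ) (f : ℝ → ℝ) :
    kestenMcKay (fun x => c * f x) = c * kestenMcKay f := by
  simp only [kestenMcKay, mul_assoc]
  rw [intervalIntegral.integral_const_mul]
  ring

theorem kestenMcKay_one : kestenMcKay (fun _ => 1) = 1 := by
  have h (θ : ℝ) : (1 : ℝ) * kestenMcKayWeight θ =
      4 * (cos (0 * θ) / (5 - 4 * cos (2 * θ))) - 4 * (cos (2 * θ) / (5 - 4 * cos (2 * θ))) := by
    rw [kestenMcKayWeight_eq, zero_mul, cos_zero, sin_sq_eq_half_sub]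
    ring
  have h1 := poissonCoeff_add_two_of_nat 1
  norm_num [poissonCoeff_zero] at h1
  simp only [kestenMcKay, h]
  rw [intervalIntegral.integral_sub ((intervalIntegrable_poissonCoeff _).const_mul _)
    ((intervalIntegrable_poissonCoeff _).const_mul _), intervalIntegral.integral_const_mul,
    intervalIntegral.integral_const_mul]
  change 3 / (2 * π) * (4 * poissonCoeff 0 - 4 * poissonCoeff 2) = 1
  rw [poissonCoeff_zero, h1]
  have := pi_ne_zero
  field_simp
  norm_num

theorem kestenMcKay_nonBacktracking_succ (k : ℕ) :
    kestenMcKay (fun x => nonBacktracking x (k + 1)) = 0 := by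
  have h (θ : ℝ) : nonBacktracking (2 * √2 * cos θ) (k + 1) * kestenMcKayWeight θ =
      4 * √2 ^ (k + 1) * (3 / 2 * (cos ((k + 1) * θ) / (5 - 4 * cos (2 * θ)))
        - cos ((k + 2 + 1) * θ) / (5 - 4 * cos (2 * θ))
        - 1 / 2 * (cos ((k - 1) * θ) / (5 - 4 * cos (2 * θ)))) := by
    have hs := nonBacktracking_two_sqrt_two_mul_cos_mul_sin θ k
    have c1 : cos ((k + 1) * θ) = cos ((k + 2) * θ - θ) := by ring_nf
    have c2 : cos ((k + 2 + 1) * θ) = cos ((k + 2) * θ + θ) := by ring_nf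
    have c3 : cos ((k + 1) * θ) = cos (k * θ + θ) := by ring_nf
    have c4 : cos ((k - 1) * θ) = cos (k * θ - θ) := by ring_nf
    rw [cos_sub] at c1 c4
    rw [cos_add] at c2 c3
    have key : nonBacktracking (2 * √2 * cos θ) (k + 1) * (8 * sin θ ^ 2) =
        4 * √2 ^ (k + 1) * (3 / 2 * cos ((k + 1) * θ) - cos ((k + 2 + 1) * θ)
          - 1 / 2 * cos ((k - 1) * θ)) := by
      linear_combination 8 * sin θ * hs - 4 * √2 ^ (k + 1) * c1 + 4 * √2 ^ (k + 1) * c2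
        - 2 * √2 ^ (k + 1) * c3 + 2 * √2 ^ (k + 1) * c4
    rw [kestenMcKayWeight_eq, ← mul_div_assoc, key]
    ring
  have h1 := poissonCoeff_add_two_of_nat k
  have h2 := poissonCoeff_add_two_of_nat (k + 2)
  push_cast at h2
  rw [show (k : ℝ) + 2 - 1 = k + 1 by ring] at h2
  simp only [kestenMcKay, h]
  rw [intervalIntegral.integral_const_mul, intervalIntegral.integral_sub
      (((intervalIntegrable_poissonCoeff _).const_mul _).sub (intervalIntegrable_poissonCoeff _))
      ((intervalIntegrable_poissonCoeff _).const_mul _),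
    intervalIntegral.integral_sub
      ((intervalIntegrable_poissonCoeff _).const_mul _) (intervalIntegrable_poissonCoeff _),
    intervalIntegral.integral_const_mul, intervalIntegral.integral_const_mul]
  change 3 / (2 * π) * (4 * √2 ^ (k + 1) * (3 / 2 * poissonCoeff (k + 1)
    - poissonCoeff (k + 2 + 1) - 1 / 2 * poissonCoeff (k - 1))) = 0
  rw [h2, h1]
  ring

theorem iharaSelbergMainTerm_eq_kestenMcKay (t : ℝ) :
    iharaSelbergMainTerm t = kestenMcKay (fun x => exp (x * t)) := by
  rw [iharaSelbergMainTerm, kestenMcKay]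
  congr 1
  have h2 : √2 ^ 2 = 2 := Real.sq_sqrt (by norm_num)
  have hsub := intervalIntegral.integral_comp_mul_deriv_of_deriv_nonpos (a := 0) (b := π)
    (f := fun θ => 2 * √2 * cos θ) (f' := fun θ => 2 * √2 * -sin θ)
    (g := fun s => exp (s * t) * √(8 - s ^ 2) / (9 - s ^ 2))
    (by fun_prop) (fun θ _ => (hasDerivAt_cos θ).const_mul _) (fun θ hθ => by
      rw [min_eq_left pi_pos.le, max_eq_right pi_pos.le] at hθ
      have := sin_pos_of_mem_Ioo hθ
      nlinarith [Real.sqrt_nonneg 2])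
  simp only [cos_zero, cos_pi, mul_one, mul_neg] at hsub
  rw [intervalIntegral.integral_symm, ← hsub, ← intervalIntegral.integral_neg]
  refine intervalIntegral.integral_congr fun θ hθ => ?_
  rw [Set.uIcc_of_le pi_pos.le] at hθ
  have hs : √(8 - (2 * √2 * cos θ) ^ 2) = 2 * √2 * sin θ := by
    rw [← Real.sqrt_sq (by have := sin_nonneg_of_mem_Icc hθ; positivity : 0 ≤ 2 * √2 * sin θ)]
    congr 1
    rw [mul_pow, mul_pow, mul_pow, mul_pow, h2, sin_sq]
    ring
  have hd : (2 * √2 * cos θ) ^ 2 = 8 * cos θ ^ 2 := by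
    rw [mul_pow, mul_pow, h2]; norm_num
  simp only [Function.comp, hs, kestenMcKayWeight]
  rw [hd]
  linear_combination (4 * exp (2 * √2 * cos θ * t) * sin θ ^ 2 / (9 - 8 * cos θ ^ 2)) * h2

theorem hasSum_pow_mul_exp (x t : ℝ) :
    HasSum (fun m : ℕ => t ^ m / m.factorial * x ^ m) (exp (x * t)) := by
  rw [Real.exp_eq_exp_ℝ]
  refine (NormedSpace.expSeries_div_hasSum_exp (x * t)).congr_fun fun m => ?_
  rw [mul_pow]
  ring

theorem hasSum_kestenMcKay_exp (t : ℝ) :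
    HasSum (fun m : ℕ => t ^ m / m.factorial * kestenMcKay (fun x => x ^ m))
      (kestenMcKay (fun x => exp (x * t))) := by
  have hw := continuous_kestenMcKayWeight
  simp only [← kestenMcKay_const_mul]
  refine HasSum.mul_left _ (intervalIntegral.hasSum_integral_of_dominated_convergence
    (fun m θ => |t| ^ m / m.factorial * |2 * √2 * cos θ| ^ m * |kestenMcKayWeight θ|)
    (fun m => Continuous.aestronglyMeasurable (by fun_prop)) (fun m => ?_) ?_ ?_ ?_)
  · refine Filter.Eventually.of_forall fun θ _ => le_of_eq ?_
    rw [Real.norm_eq_abs, abs_mul, abs_mul, abs_div, abs_pow, abs_pow, Nat.abs_cast]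
  · exact Filter.Eventually.of_forall fun θ _ => (hasSum_pow_mul_exp _ _).summable.mul_right _
  · simp only [fun θ => ((hasSum_pow_mul_exp |2 * √2 * cos θ| |t|).mul_right
      |kestenMcKayWeight θ|).tsum_eq]
    exact Continuous.intervalIntegrable (by fun_prop) _ _
  · exact Filter.Eventually.of_forall fun θ _ => (hasSum_pow_mul_exp _ _).mul_right _

section Graph

variable {V : Type*} [Fintype V] [DecidableEq V] (G : SimpleGraph V) [DecidableRel G.Adj]

/-- The number of non-backtracking walks of length `k` from `u` to `v` whose first step does not
go to `w`. -/
noncomputable def nonBacktrackingAvoiding (v : V) : ℕ → V → V → ℝ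
  | 0, _, u => if u = v then 1 else 0
  | k + 1, w, u => ∑ x ∈ (G.neighborFinset u).erase w, nonBacktrackingAvoiding v k u x

theorem nonBacktrackingAvoiding_nonneg (v : V) (k : ℕ) (w u : V) :
    0 ≤ nonBacktrackingAvoiding G v k w u := by
  induction k generalizing w u with
  | zero => simp only [nonBacktrackingAvoiding]; split_ifs <;> norm_num
  | succ k ih => exact Finset.sum_nonneg fun x _ => ih _ _

variable {G}

theorem nonBacktracking_adjMatrix_apply (hreg : G.IsRegularOfDegree 3) (k : ℕ) (u v : V) :
    nonBacktracking (G.adjMatrix ℝ) (k + 1) u v =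
      ∑ x ∈ G.neighborFinset u, nonBacktrackingAvoiding G v k u x := by
  have herase (k : ℕ) {u w : V} (h : w ∈ G.neighborFinset u) :
      nonBacktrackingAvoiding G v (k + 1) w u =
        ∑ x ∈ G.neighborFinset u, nonBacktrackingAvoiding G v k u x
          - nonBacktrackingAvoiding G v k u w := by
    rw [nonBacktrackingAvoiding, Finset.sum_erase_eq_sub h]
  have hsymm {u w : V} (h : w ∈ G.neighborFinset u) : u ∈ G.neighborFinset w := by
    simpa [G.adj_comm] using h
  have hcard (u : V) : (G.neighborFinset u).card = 3 := hreg u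
  induction k using Nat.twoStepInduction generalizing u with
  | zero =>
    simp [nonBacktracking, nonBacktrackingAvoiding, SimpleGraph.adjMatrix_apply]
  | one =>
    rw [Finset.sum_congr rfl fun x hx => herase 0 (hsymm hx), Finset.sum_sub_distrib]
    have h3 : (3 : Matrix V V ℝ) u v = if u = v then 3 else 0 := by
      rw [show (3 : Matrix V V ℝ) = Matrix.diagonal fun _ => 3 from rfl, Matrix.diagonal_apply]
    simp only [nonBacktracking, nonBacktrackingAvoiding, Matrix.sub_apply,
      SimpleGraph.adjMatrix_mul_apply, h3, Finset.sum_const, hcard]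
    congr 1
    · simp [SimpleGraph.adjMatrix_apply]
    · split_ifs <;> simp
  | more k h0 h1 =>
    have hA : nonBacktracking (G.adjMatrix ℝ) (k + 2 + 1) u v =
        ∑ x ∈ G.neighborFinset u, nonBacktracking (G.adjMatrix ℝ) (k + 1 + 1) x v
          - 2 * nonBacktracking (G.adjMatrix ℝ) (k + 1) u v := by
      simp only [nonBacktracking, Matrix.sub_apply, SimpleGraph.adjMatrix_mul_apply, two_mul,
        Matrix.add_apply]
    rw [Finset.sum_congr rfl fun x hx => herase (k + 1) (hsymm hx), Finset.sum_sub_distrib,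
      Finset.sum_congr rfl fun x hx => herase k hx, Finset.sum_sub_distrib, hA, h0,
      Finset.sum_congr rfl fun x _ => h1 x]
    simp only [Finset.sum_const, hcard]
    ring

theorem kestenMcKay_pow_mul_nonBacktracking_le (hreg : G.IsRegularOfDegree 3) (m k : ℕ) :
    Fintype.card V * kestenMcKay (fun x => x ^ m * nonBacktracking x k) ≤
      (G.adjMatrix ℝ ^ m * nonBacktracking (G.adjMatrix ℝ) k).trace := by
  induction m generalizing k with
  | zero =>
    cases k with
    | zero => simp [nonBacktracking, kestenMcKay_one]
    | succ k =>
      simp only [pow_zero, one_mul, kestenMcKay_nonBacktracking_succ, mul_zero]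
      refine Finset.sum_nonneg fun u _ => ?_
      rw [Matrix.diag_apply, nonBacktracking_adjMatrix_apply hreg]
      exact Finset.sum_nonneg fun x _ => nonBacktrackingAvoiding_nonneg G u k u x
  | succ m ih =>
    have hc := continuous_nonBacktracking
    have hf (x : ℝ) : x ^ (m + 1) * nonBacktracking x k = x ^ m * nonBacktracking x (k + 1) +
        nonBacktrackingCoeff k * (x ^ m * nonBacktracking x (k - 1)) := by
      rw [pow_succ, mul_assoc, mul_nonBacktracking, nsmul_eq_mul]
      ring
    have h1 := ih (k + 1)
    have h2 := mul_le_mul_of_nonneg_left (ih (k - 1)) (Nat.cast_nonneg (nonBacktrackingCoeff k))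
    simp only [hf]
    rw [kestenMcKay_add (by fun_prop) (by fun_prop), kestenMcKay_const_mul, pow_succ, mul_assoc,
      mul_nonBacktracking, mul_add, mul_add, Matrix.trace_add, mul_smul_comm, Matrix.trace_smul,
      nsmul_eq_mul]
    linarith

end Graph

theorem Matrix.IsHermitian.trace_pow_eq_sum_eigenvalues_pow {n : Type*} [Fintype n]
    [DecidableEq n] {A : Matrix n n ℝ} (hA : A.IsHermitian) (m : ℕ) :
    (A ^ m).trace = ∑ i, hA.eigenvalues i ^ m := by
  conv_lhs => rw [hA.spectral_theorem, ← map_pow, Unitary.conjStarAlgAut_apply,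
    Matrix.trace_mul_cycle, Unitary.coe_star_mul_self, one_mul, Matrix.diagonal_pow,
    Matrix.trace_diagonal]
  simp

/-- For a finite simple cubic graph `G` on `n ≥ 1` vertices with
adjacency eigenvalues `λ_1, …, λ_n`, the mean `μ = (1/n) ∑ e^{λ_i/3}` satisfies
`μ ≥ J(1/3)`. -/
theorem mean_exp_eigenvalues_ge_J_one_third
    {V : Type*} [Fintype V] [DecidableEq V]
    (G : SimpleGraph V) [DecidableRel G.Adj]
    (hn : 1 ≤ Fintype.card V)
    (hreg : G.IsRegularOfDegree 3)
    (hA : (G.adjMatrix ℝ).IsHermitian)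
    (μ : ℝ)
    (hμ : μ = (1 / (Fintype.card V : ℝ)) * ∑ i, Real.exp (hA.eigenvalues i / 3)) :
    μ ≥ iharaSelbergMainTerm (1 / 3) := by
  have hcard : (0 : ℝ) < Fintype.card V := by exact_mod_cast hn
  have hsum : HasSum
      (fun m : ℕ => (1 / 3 : ℝ) ^ m / m.factorial * ∑ i, hA.eigenvalues i ^ m)
      (∑ i, exp (hA.eigenvalues i * (1 / 3))) := by
    simp only [Finset.mul_sum]
    exact hasSum_sum fun i _ => hasSum_pow_mul_exp _ _
  have hle := hasSum_le (fun m => ?_)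
    ((hasSum_kestenMcKay_exp (1 / 3)).mul_left (Fintype.card V : ℝ)) hsum
  · rw [hμ, iharaSelbergMainTerm_eq_kestenMcKay, ge_iff_le, one_div_mul_eq_div,
      le_div_iff₀' hcard]
    simpa only [mul_one_div, ← div_eq_mul_inv] using hle
  · have h := kestenMcKay_pow_mul_nonBacktracking_le hreg m 0
    simp only [nonBacktracking, mul_one, hA.trace_pow_eq_sum_eigenvalues_pow] at h
    rw [mul_left_comm]
    exact mul_le_mul_of_nonneg_left h (by positivity)
end

section
/- Let G be a finite simple 3-regular (cubic) graph on n ≥ 1 vertices with adjacency-matrix eigenvalues λ_1, …, λ_n, let μ = (1/n)·∑_{i=1}^n e^{λ_i/3}, and let σ = (1/n)·∑_{i=1}^n (e^{λ_i/3} − μ)². Then σ ≥ J(2/3) − J(1/3)², where J(t) = (3/(2π)) · ∫_{−2√2}^{2√2} e^{s·t} · √(8 − s²)/(9 − s²) ds. -/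
section

open Polynomial

/-- The polynomials `p_r` with `p_0 = 1`, `p_1 = X`, `p_2 = X² - 3` and
`p_{r+1} = p_r X - 2 p_{r-1}`: evaluated at the adjacency matrix of a cubic graph, `p_r` counts
non-backtracking walks of length `r`. -/
noncomputable def nonbacktrackingPoly : ℕ → ℝ[X]
  | 0 => 1
  | 1 => X
  | 2 => X * X - C 3
  | r + 3 => nonbacktrackingPoly (r + 2) * X - C 2 * nonbacktrackingPoly (r + 1)

/-- A linear functional that is nonnegative on all `p_r` is nonnegative on all powers of `X`. -/
theorem map_X_pow_nonneg_of_nonbacktrackingPoly {L : ℝ[X] →ₗ[ℝ] ℝ}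
    (hL : ∀ r, 0 ≤ L (nonbacktrackingPoly r)) (k : ℕ) : 0 ≤ L (X ^ k) := by
  suffices h : ∀ k r, 0 ≤ L (X ^ k * nonbacktrackingPoly r) by
    simpa [nonbacktrackingPoly] using h k 0
  intro k
  induction k with
  | zero => simpa using hL
  | succ k ih =>
    intro r
    match r with
    | 0 => simpa [nonbacktrackingPoly, pow_succ] using ih 1
    | 1 =>
      have : (X : ℝ[X]) ^ (k + 1) * nonbacktrackingPoly 1 =
          X ^ k * nonbacktrackingPoly 2 + (3 : ℝ) • (X ^ k * nonbacktrackingPoly 0) := by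
        simp only [nonbacktrackingPoly, smul_eq_C_mul]; ring
      rw [this, map_add, map_smul, smul_eq_mul]
      linarith [ih 2, ih 0]
    | r + 2 =>
      have : (X : ℝ[X]) ^ (k + 1) * nonbacktrackingPoly (r + 2) =
          X ^ k * nonbacktrackingPoly (r + 3) +
            (2 : ℝ) • (X ^ k * nonbacktrackingPoly (r + 1)) := by
        simp only [nonbacktrackingPoly, smul_eq_C_mul]; ring
      rw [this, map_add, map_smul, smul_eq_mul]
      linarith [ih (r + 3), ih (r + 1)]

section Graph

variable {V : Type*} [Fintype V] [DecidableEq V]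

/-- `nonbacktrackingCount A u r x y` is the number of non-backtracking walks of length `r + 1`
from `u` whose last step is `x → y`, in the graph with adjacency matrix `A`. -/
noncomputable def nonbacktrackingCount (A : Matrix V V ℝ) (u : V) : ℕ → V → V → ℝ
  | 0, x, y => if x = u then A x y else 0
  | r + 1, x, y =>
    A x y * (∑ z, nonbacktrackingCount A u r z x - nonbacktrackingCount A u r y x)

theorem nonbacktrackingCount_nonneg {A : Matrix V V ℝ} (hA : ∀ x y, 0 ≤ A x y) (u : V) (r : ℕ)
    (x y : V) : 0 ≤ nonbacktrackingCount A u r x y := by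
  induction r generalizing x y with
  | zero => unfold nonbacktrackingCount; split_ifs <;> simp [hA]
  | succ r ih =>
    refine mul_nonneg (hA x y) (sub_nonneg.2 ?_)
    exact Finset.single_le_sum (f := fun z => nonbacktrackingCount A u r z x)
      (fun z _ => ih z x) (Finset.mem_univ y)

variable (G : SimpleGraph V) [DecidableRel G.Adj]

theorem adjMatrix_mul_nonbacktrackingCount (u : V) (r : ℕ) (x y : V) :
    G.adjMatrix ℝ x y * nonbacktrackingCount (G.adjMatrix ℝ) u r y x =
      nonbacktrackingCount (G.adjMatrix ℝ) u r y x := by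
  cases r <;> by_cases h : G.Adj x y <;> simp [nonbacktrackingCount, h, G.adj_comm y x]

variable {G}

omit [DecidableEq V] in
theorem sum_adjMatrix_of_isRegularOfDegree {d : ℕ} (hreg : G.IsRegularOfDegree d) (x : V) :
    ∑ y, G.adjMatrix ℝ x y = d := by
  simp [SimpleGraph.adjMatrix_apply, ← hreg x, ← SimpleGraph.card_neighborFinset_eq_degree,
    SimpleGraph.neighborFinset_eq_filter]

theorem sum_nonbacktrackingCount_succ (hreg : G.IsRegularOfDegree 3) (u : V) (r : ℕ) (x : V) :
    ∑ y, nonbacktrackingCount (G.adjMatrix ℝ) u (r + 1) x y =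
      2 * ∑ z, nonbacktrackingCount (G.adjMatrix ℝ) u r z x := by
  simp only [nonbacktrackingCount, mul_sub, Finset.sum_sub_distrib,
    adjMatrix_mul_nonbacktrackingCount, ← Finset.sum_mul, sum_adjMatrix_of_isRegularOfDegree hreg]
  push_cast; ring

theorem aeval_adjMatrix_nonbacktrackingPoly_succ (hreg : G.IsRegularOfDegree 3) (r : ℕ) (u y : V) :
    aeval (G.adjMatrix ℝ) (nonbacktrackingPoly (r + 1)) u y =
      ∑ x, nonbacktrackingCount (G.adjMatrix ℝ) u r x y := by
  have hsymm : ∀ r x y, G.adjMatrix ℝ x y * nonbacktrackingCount (G.adjMatrix ℝ) u r y x =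
      nonbacktrackingCount (G.adjMatrix ℝ) u r y x := adjMatrix_mul_nonbacktrackingCount G u
  induction r using Nat.strong_induction_on generalizing y with
  | _ r ih =>
    match r with
    | 0 => simp [nonbacktrackingPoly, nonbacktrackingCount]
    | 1 =>
      simp only [nonbacktrackingPoly, nonbacktrackingCount, mul_sub, Finset.sum_sub_distrib,
        map_sub, map_mul, aeval_X, Matrix.sub_apply, aeval_C, Matrix.mul_apply]
      congr 1
      · refine Finset.sum_congr rfl fun x _ => ?_
        simp [mul_comm]
      · rcases eq_or_ne u y with rfl | h
        · have := sum_adjMatrix_of_isRegularOfDegree hreg u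
          simp_all [Matrix.algebraMap_matrix_apply, G.adj_comm]
        · simp [Matrix.algebraMap_matrix_apply, h, h.symm]
    | r + 2 =>
      have h1 := ih (r + 1) (by omega)
      have h2 := ih r (by omega)
      simp only [nonbacktrackingPoly, map_sub, map_mul, aeval_X, Matrix.sub_apply, aeval_C,
        Matrix.mul_apply, h1, ← Algebra.smul_def, Matrix.smul_apply, smul_eq_mul, h2]
      rw [← sum_nonbacktrackingCount_succ hreg]
      conv_rhs => enter [2, x]; rw [nonbacktrackingCount]
      simp only [mul_sub, Finset.sum_sub_distrib, hsymm]
      congr 1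
      exact Finset.sum_congr rfl fun x _ => mul_comm _ _

theorem trace_aeval_nonbacktrackingPoly_nonneg (hreg : G.IsRegularOfDegree 3) (r : ℕ) :
    0 ≤ (aeval (G.adjMatrix ℝ) (nonbacktrackingPoly r)).trace := by
  refine Finset.sum_nonneg fun u _ => ?_
  rw [Matrix.diag_apply]
  cases r with
  | zero => simp [nonbacktrackingPoly]
  | succ r =>
    rw [aeval_adjMatrix_nonbacktrackingPoly_succ hreg]
    refine Finset.sum_nonneg fun x _ => nonbacktrackingCount_nonneg (fun x y => ?_) _ _ _ _
    rw [SimpleGraph.adjMatrix_apply]; split_ifs <;> norm_num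

theorem trace_aeval_eq_sum_eigenvalues {A : Matrix V V ℝ} (hA : A.IsHermitian) (q : ℝ[X]) :
    (aeval A q).trace = ∑ i, q.eval (hA.eigenvalues i) := by
  conv_lhs => rw [hA.spectral_theorem]
  rw [Polynomial.aeval_algHom_apply, Unitary.conjStarAlgAut_apply, Matrix.trace_mul_comm,
    ← mul_assoc, Unitary.coe_star_mul_self, one_mul]
  have : aeval (Matrix.diagonal (RCLike.ofReal ∘ hA.eigenvalues) : Matrix V V ℝ) q =
      Matrix.diagonal (fun i => q.eval (hA.eigenvalues i)) := by
    have h := Polynomial.aeval_algHom_apply (Matrix.diagonalAlgHom ℝ (n := V) (α := ℝ))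
      hA.eigenvalues q
    simp only [Matrix.diagonalAlgHom_apply] at h
    refine h.trans (congrArg _ (funext fun i => ?_))
    rw [Polynomial.aeval_fn_apply]
    simp
  rw [this]
  simp [Matrix.trace]

theorem eigenvalues_adjMatrix_le {d : ℕ} (hreg : G.IsRegularOfDegree d)
    (hA : (G.adjMatrix ℝ).IsHermitian) (i : V) : hA.eigenvalues i ≤ d := by
  have h : Module.End.HasEigenvalue (Matrix.toLin' (G.adjMatrix ℝ)) (hA.eigenvalues i) := by
    rw [Module.End.hasEigenvalue_iff_mem_spectrum, Matrix.spectrum_toLin']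
    exact hA.eigenvalues_mem_spectrum_real i
  obtain ⟨k, hk⟩ := eigenvalue_mem_ball h
  have hs : ∑ j ∈ Finset.univ.erase k, ‖G.adjMatrix ℝ k j‖ ≤ d := by
    rw [← sum_adjMatrix_of_isRegularOfDegree hreg k]
    refine (Finset.sum_le_sum_of_subset_of_nonneg (Finset.subset_univ _)
      fun _ _ _ => norm_nonneg _).trans_eq (Finset.sum_congr rfl fun j _ => ?_)
    rw [SimpleGraph.adjMatrix_apply]; split_ifs <;> simp
  simp only [SimpleGraph.adjMatrix_apply, G.irrefl, if_false, Metric.mem_closedBall,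
    Real.dist_eq, sub_zero] at hk hs
  exact (le_abs_self _).trans (hk.trans hs)

end Graph

section KestenMcKay

/-- The holomorphic function on the closed unit disc whose real part on the unit circle is `p_r`
times the Kesten-McKay density (for `r ≥ 1`), after the substitution `s = 2√2 cos θ`. -/
noncomputable def kestenMcKayHolo (r : ℕ) (w : ℂ) : ℂ :=
  2 * (Real.sqrt 2 : ℂ) ^ r * w ^ r * (1 - w ^ 2) / (2 - w ^ 2)

theorem two_sub_sq_ne_zero {w : ℂ} (hw : ‖w‖ ≤ 1) : 2 - w ^ 2 ≠ 0 := by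
  intro h
  have h2 : ‖w‖ ^ 2 = 2 := by rw [← norm_pow, ← sub_eq_zero.1 h]; simp
  nlinarith [norm_nonneg w]

theorem differentiableAt_kestenMcKayHolo (r : ℕ) {w : ℂ} (hw : ‖w‖ ≤ 1) :
    DifferentiableAt ℂ (kestenMcKayHolo r) w := by
  unfold kestenMcKayHolo
  exact DifferentiableAt.div (by fun_prop) (by fun_prop) (two_sub_sq_ne_zero hw)

theorem continuous_kestenMcKayHolo_circleMap (r : ℕ) :
    Continuous fun θ : ℝ => kestenMcKayHolo r (circleMap 0 1 θ) :=
  continuous_iff_continuousAt.2 fun θ =>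
    (differentiableAt_kestenMcKayHolo r (by simp)).continuousAt.comp
      (continuous_circleMap 0 1).continuousAt

theorem integral_re_kestenMcKayHolo (r : ℕ) :
    ∫ θ in (0 : ℝ)..2 * Real.pi, (kestenMcKayHolo r (circleMap 0 1 θ)).re =
      2 * Real.pi * (kestenMcKayHolo r 0).re := by
  have h : Real.circleAverage (kestenMcKayHolo r) 0 1 = kestenMcKayHolo r 0 := by
    apply circleAverage_of_differentiable_on_off_countable Set.countable_empty
    · exact fun w hw => (differentiableAt_kestenMcKayHolo r
        (by simpa using hw)).continuousAt.continuousWithinAt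
    · exact fun w hw => differentiableAt_kestenMcKayHolo r (by
        simpa using (Metric.ball_subset_closedBall hw.1))
  rw [← h, Real.circleAverage_def, Complex.smul_re, smul_eq_mul,
    mul_inv_cancel_left₀ Real.two_pi_pos.ne']
  exact Complex.reCLM.intervalIntegral_comp_comm
    ((continuous_kestenMcKayHolo_circleMap r).intervalIntegrable _ _)

theorem kestenMcKayHolo_recurrence (r : ℕ) (θ : ℝ) :
    ((2 * Real.sqrt 2 * Real.cos θ : ℝ) : ℂ) * kestenMcKayHolo (r + 1) (circleMap 0 1 θ) =
      kestenMcKayHolo (r + 2) (circleMap 0 1 θ) + 2 * kestenMcKayHolo r (circleMap 0 1 θ) := by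
  have h2 : (Real.sqrt 2 : ℂ) ^ 2 = 2 := by exact_mod_cast Real.sq_sqrt zero_le_two
  have hw : 2 * (Real.cos θ : ℂ) * circleMap 0 1 θ = circleMap 0 1 θ ^ 2 + 1 := by
    simp only [circleMap, Complex.ofReal_cos, Complex.cos, Complex.ofReal_one, zero_add, one_mul]
    have : Complex.exp (-θ * Complex.I) * Complex.exp (θ * Complex.I) = 1 := by
      rw [← Complex.exp_add]; simp
    linear_combination this
  have hne := two_sub_sq_ne_zero (w := circleMap 0 1 θ) (by simp)
  simp only [kestenMcKayHolo, Complex.ofReal_mul, Complex.ofReal_ofNat]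
  generalize (Real.cos θ : ℂ) = c at *
  generalize circleMap 0 1 θ = w at *
  generalize (Real.sqrt 2 : ℂ) = a at *
  field_simp
  linear_combination (a ^ r * w ^ r * (1 - w ^ 2)) * (a ^ 2 * hw + h2)

/-- The Kesten-McKay density after the substitution `s = 2√2 cos θ`. -/
noncomputable def kestenMcKayAngle (θ : ℝ) : ℝ :=
  8 * Real.sin θ ^ 2 / (9 - 8 * Real.cos θ ^ 2)

theorem nine_sub_cos_sq_pos (θ : ℝ) : 0 < 9 - 8 * Real.cos θ ^ 2 := by
  nlinarith [Real.cos_sq_le_one θ]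

theorem re_kestenMcKayHolo (r : ℕ) (θ : ℝ) :
    (kestenMcKayHolo r (circleMap 0 1 θ)).re = 2 * Real.sqrt 2 ^ r *
      ((circleMap 0 1 θ ^ r).re * (3 * (1 - Real.cos (2 * θ))) +
      (circleMap 0 1 θ ^ r).im * Real.sin (2 * θ)) / (9 - 8 * Real.cos θ ^ 2) := by
  have hpos := nine_sub_cos_sq_pos θ
  have hw : circleMap 0 1 θ ^ 2 = ⟨Real.cos (2 * θ), Real.sin (2 * θ)⟩ := by
    simp only [circleMap, Complex.ofReal_one, zero_add, one_mul, ← Complex.exp_nat_mul]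
    apply Complex.ext <;> simp [Complex.exp_re, Complex.exp_im]
  have hne := two_sub_sq_ne_zero (w := circleMap 0 1 θ) (by simp)
  have hn : Complex.normSq (2 - circleMap 0 1 θ ^ 2) = 9 - 8 * Real.cos θ ^ 2 := by
    rw [hw, Complex.normSq_apply]
    simp
    rw [Real.cos_two_mul]
    nlinarith [Real.sin_sq_add_cos_sq (2 * θ), Real.cos_two_mul θ]
  have hr : kestenMcKayHolo r (circleMap 0 1 θ) = ((2 * Real.sqrt 2 ^ r : ℝ) : ℂ) *
      (circleMap 0 1 θ ^ r * (1 - circleMap 0 1 θ ^ 2) / (2 - circleMap 0 1 θ ^ 2)) := by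
    rw [kestenMcKayHolo]; push_cast; ring
  have h1 := Real.sin_sq_add_cos_sq (2 * θ)
  rw [hr, Complex.re_ofReal_mul, Complex.div_re, hn, hw]
  generalize circleMap 0 1 θ ^ r = v
  simp only [Complex.mul_re, Complex.mul_im, Complex.sub_re, Complex.sub_im, Complex.one_re,
    Complex.one_im, Complex.re_ofNat, Complex.im_ofNat]
  field_simp
  linear_combination v.re * h1

theorem re_kestenMcKayHolo_zero (θ : ℝ) :
    (kestenMcKayHolo 0 (circleMap 0 1 θ)).re = (3 / 2) * kestenMcKayAngle θ := by
  rw [re_kestenMcKayHolo, kestenMcKayAngle, Real.cos_two_mul, Real.sin_sq]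
  simp only [pow_zero, Complex.one_re, Complex.one_im]
  ring

theorem eval_nonbacktrackingPoly_mul_kestenMcKayAngle (r : ℕ) (θ : ℝ) :
    (nonbacktrackingPoly (r + 1)).eval (2 * Real.sqrt 2 * Real.cos θ) * kestenMcKayAngle θ =
      (kestenMcKayHolo (r + 1) (circleMap 0 1 θ)).re := by
  have hrec (r : ℕ) : 2 * Real.sqrt 2 * Real.cos θ *
      (kestenMcKayHolo (r + 1) (circleMap 0 1 θ)).re =
        (kestenMcKayHolo (r + 2) (circleMap 0 1 θ)).re +
          2 * (kestenMcKayHolo r (circleMap 0 1 θ)).re := by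
    have := congrArg Complex.re (kestenMcKayHolo_recurrence r θ)
    rw [Complex.re_ofReal_mul] at this
    simpa using this
  have h0 := re_kestenMcKayHolo_zero θ
  have h1 : 2 * Real.sqrt 2 * Real.cos θ * kestenMcKayAngle θ =
      (kestenMcKayHolo 1 (circleMap 0 1 θ)).re := by
    have hpos := nine_sub_cos_sq_pos θ
    rw [re_kestenMcKayHolo, kestenMcKayAngle, Real.cos_two_mul, Real.sin_two_mul]
    simp only [pow_one, circleMap, Complex.ofReal_one, zero_add, one_mul,
      Complex.exp_ofReal_mul_I_re, Complex.exp_ofReal_mul_I_im]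
    field_simp
    rw [Real.sin_sq]
    ring
  induction r using Nat.strong_induction_on with
  | _ r ih =>
    match r with
    | 0 => simpa [nonbacktrackingPoly] using h1
    | 1 =>
      have := hrec 0
      rw [← h1] at this
      simp only [nonbacktrackingPoly, eval_sub, eval_mul, eval_X, eval_C]
      linarith
    | r + 2 =>
      have := hrec (r + 1)
      rw [← ih (r + 1) (by omega), ← ih r (by omega)] at this
      simp only [nonbacktrackingPoly, eval_sub, eval_mul, eval_X, eval_C] at this ⊢
      linarith

theorem continuous_kestenMcKayAngle : Continuous kestenMcKayAngle :=
  Continuous.div (by fun_prop) (by fun_prop) fun θ => (nine_sub_cos_sq_pos θ).ne'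

/-- The substitution `s = 2√2 cos θ` in the Kesten-McKay integral. -/
theorem integral_mul_kestenMcKay {q : ℝ → ℝ} (hq : Continuous q) :
    ∫ s in (-(2 * Real.sqrt 2))..(2 * Real.sqrt 2), q s * Real.sqrt (8 - s ^ 2) / (9 - s ^ 2) =
      (1 / 2) * ∫ θ in (0 : ℝ)..2 * Real.pi,
        q (2 * Real.sqrt 2 * Real.cos θ) * kestenMcKayAngle θ := by
  set a := 2 * Real.sqrt 2 with ha
  have ha2 : a ^ 2 = 8 := by rw [ha, mul_pow, Real.sq_sqrt zero_le_two]; norm_num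
  have ha0 : 0 ≤ a := by positivity
  clear_value a
  set h : ℝ → ℝ := fun θ => q (a * Real.cos θ) * kestenMcKayAngle θ with hh
  have hc : Continuous h := by
    have := continuous_kestenMcKayAngle
    fun_prop
  have hsub : ∫ θ in (0 : ℝ)..Real.pi, h θ =
      ∫ s in (-a)..a, q s * Real.sqrt (8 - s ^ 2) / (9 - s ^ 2) := by
    have key := intervalIntegral.integral_comp_mul_deriv' (a := Real.pi) (b := 0)
      (f := fun θ => a * Real.cos θ) (f' := fun θ => a * -Real.sin θ)
      (g := fun s => q s * Real.sqrt (8 - s ^ 2) / (9 - s ^ 2))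
      (fun θ _ => (Real.hasDerivAt_cos θ).const_mul a) (by fun_prop) (by
        refine ContinuousOn.div (by fun_prop) (by fun_prop) ?_
        rintro _ ⟨θ, -, rfl⟩
        have := nine_sub_cos_sq_pos θ
        simp only [mul_pow, ha2]
        exact this.ne')
    simp only [Real.cos_pi, Real.cos_zero, mul_neg, mul_one, Function.comp_apply] at key
    rw [← key, intervalIntegral.integral_symm, ← intervalIntegral.integral_neg]
    refine intervalIntegral.integral_congr fun θ hθ => ?_
    rw [Set.uIcc_of_ge Real.pi_pos.le] at hθ
    have hs := Real.sin_nonneg_of_mem_Icc hθ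
    have : Real.sqrt (8 - (a * Real.cos θ) ^ 2) = a * Real.sin θ := by
      rw [show 8 - (a * Real.cos θ) ^ 2 = (a * Real.sin θ) ^ 2 by
        rw [mul_pow, mul_pow, ha2, Real.sin_sq]; ring]
      exact Real.sqrt_sq (mul_nonneg ha0 hs)
    simp only [hh, kestenMcKayAngle]
    rw [this]
    simp only [mul_pow, ha2]
    linear_combination (q (a * Real.cos θ) * Real.sin θ ^ 2 / (9 - 8 * Real.cos θ ^ 2)) * ha2
  have hsymm : ∫ θ in Real.pi..2 * Real.pi, h θ = ∫ θ in (0 : ℝ)..Real.pi, h θ := by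
    have := intervalIntegral.integral_comp_sub_left (a := 0) (b := Real.pi) h (2 * Real.pi)
    rw [sub_zero, show 2 * Real.pi - Real.pi = Real.pi by ring] at this
    rw [← this]
    refine intervalIntegral.integral_congr fun θ _ => ?_
    simp [hh, kestenMcKayAngle, Real.cos_two_pi_sub, Real.sin_two_pi_sub]
  rw [← intervalIntegral.integral_add_adjacent_intervals (hc.intervalIntegrable 0 Real.pi)
    (hc.intervalIntegrable _ _), hsymm, hsub]
  ring

theorem continuousOn_kestenMcKay {q : ℝ → ℝ} (hq : Continuous q) :
    ContinuousOn (fun s => q s * Real.sqrt (8 - s ^ 2) / (9 - s ^ 2))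
      (Set.uIcc (-(2 * Real.sqrt 2)) (2 * Real.sqrt 2)) := by
  refine ContinuousOn.div (by fun_prop) (by fun_prop) fun s hs => ?_
  rw [Set.uIcc_of_le (by linarith [Real.sqrt_nonneg 2])] at hs
  have h8 : (2 * Real.sqrt 2) ^ 2 = 8 := by rw [mul_pow, Real.sq_sqrt zero_le_two]; norm_num
  have := sq_le_sq' hs.1 hs.2
  linarith

/-- Integration of polynomials against the Kesten-McKay law of the cubic tree. -/
noncomputable def kestenMcKayFunctional : ℝ[X] →ₗ[ℝ] ℝ where
  toFun q := (3 / (2 * Real.pi)) * ∫ s in (-(2 * Real.sqrt 2))..(2 * Real.sqrt 2),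
    q.eval s * Real.sqrt (8 - s ^ 2) / (9 - s ^ 2)
  map_add' p q := by
    simp only [eval_add, add_mul, add_div]
    rw [intervalIntegral.integral_add (continuousOn_kestenMcKay p.continuous).intervalIntegrable
      (continuousOn_kestenMcKay q.continuous).intervalIntegrable, mul_add]
  map_smul' c q := by
    simp only [eval_smul, smul_eq_mul, mul_assoc, mul_div_assoc, RingHom.id_apply,
      intervalIntegral.integral_const_mul]
    ring

theorem kestenMcKayFunctional_nonbacktrackingPoly_succ (r : ℕ) :
    kestenMcKayFunctional (nonbacktrackingPoly (r + 1)) = 0 := by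
  simp only [kestenMcKayFunctional, LinearMap.coe_mk, AddHom.coe_mk]
  rw [integral_mul_kestenMcKay (nonbacktrackingPoly (r + 1)).continuous]
  simp only [eval_nonbacktrackingPoly_mul_kestenMcKayAngle, integral_re_kestenMcKayHolo]
  simp [kestenMcKayHolo]

theorem kestenMcKayFunctional_one : kestenMcKayFunctional 1 = 1 := by
  simp only [kestenMcKayFunctional, LinearMap.coe_mk, AddHom.coe_mk]
  rw [integral_mul_kestenMcKay (1 : ℝ[X]).continuous]
  have h (θ : ℝ) : (1 : ℝ[X]).eval (2 * Real.sqrt 2 * Real.cos θ) * kestenMcKayAngle θ =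
      (2 / 3) * (kestenMcKayHolo 0 (circleMap 0 1 θ)).re := by
    rw [re_kestenMcKayHolo_zero, eval_one]; ring
  simp only [h, intervalIntegral.integral_const_mul, integral_re_kestenMcKayHolo]
  have := Real.pi_ne_zero
  simp [kestenMcKayHolo]
  field_simp

theorem hasSum_iharaSelbergMainTerm (t : ℝ) :
    HasSum (fun k : ℕ => t ^ k / k.factorial * kestenMcKayFunctional (X ^ k))
      (iharaSelbergMainTerm t) := by
  have h : HasSum (fun k : ℕ => ∫ s in (-(2 * Real.sqrt 2))..(2 * Real.sqrt 2),
      t ^ k / k.factorial * (s ^ k * Real.sqrt (8 - s ^ 2) / (9 - s ^ 2)))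
      (∫ s in (-(2 * Real.sqrt 2))..(2 * Real.sqrt 2),
        Real.exp (s * t) * Real.sqrt (8 - s ^ 2) / (9 - s ^ 2)) := by
    have hsum (s : ℝ) : HasSum (fun k : ℕ => (s * t) ^ k / k.factorial) (Real.exp (s * t)) := by
      rw [Real.exp_eq_exp_ℝ]; exact NormedSpace.expSeries_div_hasSum_exp (s * t)
    have hcont := continuousOn_kestenMcKay (q := fun _ => 1) continuous_const
    refine intervalIntegral.hasSum_integral_of_dominated_convergence
      (fun k s => (2 * Real.sqrt 2 * |t|) ^ k / k.factorial *
        |1 * Real.sqrt (8 - s ^ 2) / (9 - s ^ 2)|) (fun k => ?_) (fun k => ?_) ?_ ?_ ?_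
    · exact (Measurable.aestronglyMeasurable (by fun_prop))
    · refine Filter.Eventually.of_forall fun s hs => ?_
      rw [Set.uIoc_of_le (by linarith [Real.sqrt_nonneg 2])] at hs
      have hs' : |s| ≤ 2 * Real.sqrt 2 := abs_le.2 ⟨hs.1.le, hs.2⟩
      rw [show t ^ k / k.factorial * (s ^ k * Real.sqrt (8 - s ^ 2) / (9 - s ^ 2)) =
        (s * t) ^ k / k.factorial * (1 * Real.sqrt (8 - s ^ 2) / (9 - s ^ 2)) by ring,
        norm_mul, Real.norm_eq_abs, Real.norm_eq_abs, abs_div, abs_pow, abs_mul, Nat.abs_cast]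
      gcongr
    · refine Filter.Eventually.of_forall fun s _ => ?_
      exact (Real.summable_pow_div_factorial _).mul_right _
    · simp only [tsum_mul_right]
      exact (hcont.abs.const_mul _).intervalIntegrable
    · refine Filter.Eventually.of_forall fun s _ => ?_
      rw [mul_div_assoc]
      refine ((hsum s).mul_right (Real.sqrt (8 - s ^ 2) / (9 - s ^ 2))).congr_fun fun k => ?_
      ring
  refine (h.mul_left (3 / (2 * Real.pi))).congr_fun fun k => ?_
  simp only [kestenMcKayFunctional, LinearMap.coe_mk, AddHom.coe_mk, eval_pow, eval_X,
    intervalIntegral.integral_const_mul]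
  ring

end KestenMcKay

section Main

variable {V : Type*} [Fintype V] [DecidableEq V] {G : SimpleGraph V} [DecidableRel G.Adj]

/-- The average of a polynomial over the adjacency eigenvalues. -/
noncomputable def eigenvalueAverage (hA : (G.adjMatrix ℝ).IsHermitian) : ℝ[X] →ₗ[ℝ] ℝ :=
  (1 / (Fintype.card V : ℝ)) • ∑ i, leval (hA.eigenvalues i)

theorem eigenvalueAverage_apply (hA : (G.adjMatrix ℝ).IsHermitian) (q : ℝ[X]) :
    eigenvalueAverage hA q =
      (1 / (Fintype.card V : ℝ)) * ∑ i, q.eval (hA.eigenvalues i) := by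
  simp [eigenvalueAverage, leval]

theorem eigenvalueAverage_eq_trace (hA : (G.adjMatrix ℝ).IsHermitian) (q : ℝ[X]) :
    eigenvalueAverage hA q =
      (1 / (Fintype.card V : ℝ)) * (aeval (G.adjMatrix ℝ) q).trace := by
  rw [eigenvalueAverage_apply, trace_aeval_eq_sum_eigenvalues]

theorem hasSum_average_exp_eigenvalues (hA : (G.adjMatrix ℝ).IsHermitian) (t : ℝ) :
    HasSum (fun k : ℕ => t ^ k / k.factorial * eigenvalueAverage hA (X ^ k))
      ((1 / (Fintype.card V : ℝ)) * ∑ i, Real.exp (hA.eigenvalues i * t)) := by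
  have h (s : ℝ) : HasSum (fun k : ℕ => (s * t) ^ k / k.factorial) (Real.exp (s * t)) := by
    rw [Real.exp_eq_exp_ℝ]; exact NormedSpace.expSeries_div_hasSum_exp (s * t)
  refine ((hasSum_sum fun i (_ : i ∈ Finset.univ) => h (hA.eigenvalues i)).mul_left
    (1 / (Fintype.card V : ℝ))).congr_fun fun k => ?_
  simp only [eigenvalueAverage_apply, Finset.mul_sum, eval_pow, eval_X]
  exact Finset.sum_congr rfl fun i _ => by ring

/-- The difference between the spectral moments of a cubic graph and of the cubic tree. -/
noncomputable def momentExcess (hA : (G.adjMatrix ℝ).IsHermitian) : ℝ[X] →ₗ[ℝ] ℝ :=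
  eigenvalueAverage hA - kestenMcKayFunctional

theorem momentExcess_one [Nonempty V] (hA : (G.adjMatrix ℝ).IsHermitian) :
    momentExcess hA 1 = 0 := by
  simp [momentExcess, kestenMcKayFunctional_one, eigenvalueAverage_apply]

theorem momentExcess_X_pow_nonneg [Nonempty V] (hreg : G.IsRegularOfDegree 3)
    (hA : (G.adjMatrix ℝ).IsHermitian) (k : ℕ) : 0 ≤ momentExcess hA (X ^ k) := by
  refine map_X_pow_nonneg_of_nonbacktrackingPoly (fun r => ?_) k
  cases r with
  | zero => exact (momentExcess_one hA).ge
  | succ r =>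
    rw [momentExcess, LinearMap.sub_apply, kestenMcKayFunctional_nonbacktrackingPoly_succ,
      sub_zero, eigenvalueAverage_eq_trace]
    exact mul_nonneg (by positivity) (trace_aeval_nonbacktrackingPoly_nonneg hreg _)

theorem momentExcess_X_pow_eq_zero [Nonempty V] (hreg : G.IsRegularOfDegree 3)
    (hA : (G.adjMatrix ℝ).IsHermitian) {k : ℕ} (hk : k < 3) : momentExcess hA (X ^ k) = 0 := by
  have h0 := momentExcess_one hA
  have hc : (Fintype.card V : ℝ) ≠ 0 := by simp
  interval_cases k
  · simpa using h0
  · have := kestenMcKayFunctional_nonbacktrackingPoly_succ 0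
    simp only [nonbacktrackingPoly] at this
    rw [momentExcess, LinearMap.sub_apply, pow_one, this, eigenvalueAverage_eq_trace]
    simp
  · have := kestenMcKayFunctional_nonbacktrackingPoly_succ 1
    simp only [nonbacktrackingPoly] at this
    rw [← mul_one (C (3 : ℝ)), ← smul_eq_C_mul, map_sub, map_smul, kestenMcKayFunctional_one,
      ← sq] at this
    rw [momentExcess, LinearMap.sub_apply, eigenvalueAverage_eq_trace, sub_eq_zero.1 this]
    have htr : (G.adjMatrix ℝ * G.adjMatrix ℝ).trace = 3 * Fintype.card V := by
      simp only [Matrix.trace, Matrix.diag_apply, G.adjMatrix_mul_self_apply_self, hreg.degree_eq]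
      simp [mul_comm]
    rw [map_pow, aeval_X, sq, htr]
    field_simp
    simp

/-- Doubling `t` multiplies the contribution of the cycles by at least `2³`. -/
theorem eight_mul_excess_le [Nonempty V] (hreg : G.IsRegularOfDegree 3)
    (hA : (G.adjMatrix ℝ).IsHermitian) {t : ℝ} (ht : 0 ≤ t) {a b : ℝ}
    (ha : HasSum (fun k : ℕ => t ^ k / k.factorial * momentExcess hA (X ^ k)) a)
    (hb : HasSum (fun k : ℕ => (2 * t) ^ k / k.factorial * momentExcess hA (X ^ k)) b) :
    8 * a ≤ b := by
  refine hasSum_le (fun k => ?_) (ha.mul_left 8) hb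
  rcases lt_or_ge k 3 with hk | hk
  · simp [momentExcess_X_pow_eq_zero hreg hA hk]
  · have h8 : (8 : ℝ) ≤ 2 ^ k := by
      calc (8 : ℝ) = 2 ^ 3 := by norm_num
        _ ≤ 2 ^ k := pow_le_pow_right₀ one_le_two hk
    have hnn : 0 ≤ t ^ k / k.factorial * momentExcess hA (X ^ k) :=
      mul_nonneg (by positivity) (momentExcess_X_pow_nonneg hreg hA k)
    rw [mul_pow, mul_div_assoc, mul_assoc]
    exact mul_le_mul_of_nonneg_right h8 hnn

theorem hasSum_momentExcess (hA : (G.adjMatrix ℝ).IsHermitian) (t : ℝ) :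
    HasSum (fun k : ℕ => t ^ k / k.factorial * momentExcess hA (X ^ k))
      ((1 / (Fintype.card V : ℝ)) * ∑ i, Real.exp (hA.eigenvalues i * t) -
        iharaSelbergMainTerm t) := by
  refine ((hasSum_average_exp_eigenvalues hA t).sub (hasSum_iharaSelbergMainTerm t)).congr_fun
    fun k => ?_
  rw [momentExcess, LinearMap.sub_apply, mul_sub]

end Main

end

/-- For a finite simple cubic graph `G` on `n ≥ 1` vertices with
adjacency eigenvalues `λ_1, …, λ_n`, with `μ = (1/n) ∑ e^{λ_i/3}` and
`σ = (1/n) ∑ (e^{λ_i/3} - μ)²`, one has `σ ≥ J(2/3) - J(1/3)²`. -/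
theorem variance_exp_eigenvalues_ge_initial_point
    {V : Type*} [Fintype V] [DecidableEq V]
    (G : SimpleGraph V) [DecidableRel G.Adj]
    (hn : 1 ≤ Fintype.card V)
    (hreg : G.IsRegularOfDegree 3)
    (hA : (G.adjMatrix ℝ).IsHermitian)
    (μ σ : ℝ)
    (hμ : μ = (1 / (Fintype.card V : ℝ)) * ∑ i, Real.exp (hA.eigenvalues i / 3))
    (hσ : σ = (1 / (Fintype.card V : ℝ)) *
      ∑ i, (Real.exp (hA.eigenvalues i / 3) - μ) ^ 2) :
    σ ≥ iharaSelbergMainTerm (2 / 3) - iharaSelbergMainTerm (1 / 3) ^ 2 := by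
  have : Nonempty V := Fintype.card_pos_iff.1 hn
  have hc : (0 : ℝ) < Fintype.card V := by exact_mod_cast hn
  have h1 := hasSum_momentExcess hA (1 / 3)
  have h2 := hasSum_momentExcess hA (2 / 3)
  have h8 := eight_mul_excess_le hreg hA (t := 1 / 3) (by norm_num) h1
    (by rw [show (2 : ℝ) * (1 / 3) = 2 / 3 by norm_num]; exact h2)
  have hnn := h1.nonneg fun k =>
    mul_nonneg (by positivity) (momentExcess_X_pow_nonneg hreg hA k)
  have hμ' : (1 / (Fintype.card V : ℝ)) * ∑ i, Real.exp (hA.eigenvalues i * (1 / 3)) = μ := by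
    rw [hμ]; simp only [mul_one_div]
  have hσ' : σ = (1 / (Fintype.card V : ℝ)) * ∑ i, Real.exp (hA.eigenvalues i * (2 / 3)) -
      μ ^ 2 := by
    have hsq (i : V) : (Real.exp (hA.eigenvalues i / 3) - μ) ^ 2 =
        Real.exp (hA.eigenvalues i * (2 / 3)) - 2 * μ * Real.exp (hA.eigenvalues i / 3) +
          μ ^ 2 := by
      rw [show hA.eigenvalues i * (2 / 3) = hA.eigenvalues i / 3 + hA.eigenvalues i / 3 by ring,
        Real.exp_add]
      ring
    have hsum : ∑ i, Real.exp (hA.eigenvalues i / 3) = Fintype.card V * μ := by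
      rw [hμ]; field_simp
    rw [hσ]
    simp only [hsq, Finset.sum_add_distrib, Finset.sum_sub_distrib, ← Finset.mul_sum, hsum,
      Finset.sum_const, Finset.card_univ, nsmul_eq_mul]
    generalize ∑ i, Real.exp (hA.eigenvalues i * (2 / 3)) = S
    field_simp
    ring
  have hμ4 : μ ≤ 4 := by
    have hle : ∑ i, Real.exp (hA.eigenvalues i / 3) ≤ ∑ _i : V, (4 : ℝ) := by
      refine Finset.sum_le_sum fun i _ => ?_
      have hi := eigenvalues_adjMatrix_le hreg hA i
      push_cast at hi
      exact (Real.exp_le_exp.2 (by linarith : hA.eigenvalues i / 3 ≤ 1)).trans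
        (by linarith [Real.exp_one_lt_d9])
    rw [hμ, one_div, inv_mul_le_iff₀ hc]
    simpa using hle
  rw [hμ'] at h8 hnn
  nlinarith [mul_nonneg hnn (by linarith : 0 ≤ 8 - μ - iharaSelbergMainTerm (1 / 3))]
end
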